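/- arXiv:2409.05645 — 7 statements merged into one kernel-verified Lean document; each statement's English description precedes it below -/
import Mathlib

section
/- Let d ≥ 1 and N ≥ 1 be integers, let q = (q₁,…,q_N) ∈ (ℝ^d)^N have pairwise distinct components, and let γ ∈ (0,1] and s ≥ 0. Then ∑_{i=1}^N ⟨ ∑_{j≠i} (qᵢ−qⱼ)/|qᵢ−qⱼ|^γ , ∑_{k≠i} (qᵢ−qₖ)/|qᵢ−qₖ|^{s+1} ⟩ ≥ 2 ∑_{1≤i<j≤N} 1/|qᵢ−qⱼ|^{s+γ−1}. (Lemma A.1) -/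
open scoped RealInnerProductSpace

/-- With `x, y, z` the sides of a triangle and `z` the longest, the sum over the vertices of the
weighted cosines is nonnegative (after multiplication by `2xyz`). -/
lemma weighted_cosine_sum_nonneg_of_longest {x y z fx fy fz gx gy gz : ℝ}
    (hx : 0 < x) (hy : 0 < y) (hz : 0 < z)
    (hxz : x ≤ z) (hyz : y ≤ z) (htri : z ≤ x + y)
    (hfx : 0 ≤ fx) (hfy : 0 ≤ fy) (hfxz : fx ≤ fz) (hfyz : fy ≤ fz)
    (hgx : 0 ≤ gx) (hgy : 0 ≤ gy) (hgz : 0 ≤ gz) :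
    0 ≤ x * (y ^ 2 + z ^ 2 - x ^ 2) * (fy * gz + fz * gy)
      + y * (x ^ 2 + z ^ 2 - y ^ 2) * (fx * gz + fz * gx)
      + z * (x ^ 2 + y ^ 2 - z ^ 2) * (fx * gy + fy * gx) := by
  have hfz : 0 ≤ fz := hfx.trans hfxz
  have hA : 0 ≤ x * (y ^ 2 + z ^ 2 - x ^ 2) := mul_nonneg hx.le (by nlinarith)
  have hB : 0 ≤ y * (x ^ 2 + z ^ 2 - y ^ 2) := mul_nonneg hy.le (by nlinarith)
  have hA' := mul_nonneg hA (by positivity : 0 ≤ fy * gz + fz * gy)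
  have hB' := mul_nonneg hB (by positivity : 0 ≤ fx * gz + fz * gx)
  rcases le_total 0 (x ^ 2 + y ^ 2 - z ^ 2) with hC | hC
  · have : 0 ≤ z * (x ^ 2 + y ^ 2 - z ^ 2) * (fx * gy + fy * gx) := by positivity
    linarith
  · have hAC : 0 ≤ (x + z) * ((y - x + z) * (y + x - z)) :=
      mul_nonneg (by linarith) (mul_nonneg (by linarith) (by linarith))
    have hBC : 0 ≤ (y + z) * ((x - y + z) * (x + y - z)) :=
      mul_nonneg (by linarith) (mul_nonneg (by linarith) (by linarith))
    have h1 := mul_nonneg (mul_nonneg hfz hgy) hAC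
    have h2 := mul_nonneg (mul_nonneg hfz hgx) hBC
    have h3 := mul_nonneg hA (mul_nonneg hfy hgz)
    have h4 := mul_nonneg hB (mul_nonneg hfx hgz)
    have h5 : 0 ≤ z * (z ^ 2 - x ^ 2 - y ^ 2) * ((fz - fx) * gy + (fz - fy) * gx) :=
      mul_nonneg (mul_nonneg hz.le (by linarith))
        (add_nonneg (mul_nonneg (by linarith) hgy) (mul_nonneg (by linarith) hgx))
    linear_combination h1 + h2 + h3 + h4 + h5

lemma weighted_cosine_sum_nonneg {f g : ℝ → ℝ} (hf : MonotoneOn f (Set.Ioi 0))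
    (hf0 : ∀ t, 0 < t → 0 ≤ f t) (hg0 : ∀ t, 0 < t → 0 ≤ g t) {x y z : ℝ}
    (hx : 0 < x) (hy : 0 < y) (hz : 0 < z)
    (hxt : x ≤ y + z) (hyt : y ≤ x + z) (hzt : z ≤ x + y) :
    0 ≤ x * (y ^ 2 + z ^ 2 - x ^ 2) * (f y * g z + f z * g y)
      + y * (x ^ 2 + z ^ 2 - y ^ 2) * (f x * g z + f z * g x)
      + z * (x ^ 2 + y ^ 2 - z ^ 2) * (f x * g y + f y * g x) := by
  have key : ∀ {a b c : ℝ}, 0 < a → 0 < b → 0 < c → a ≤ c → b ≤ c → c ≤ a + b → _ :=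
    fun {a b c} ha hb hc hac hbc ht =>
      weighted_cosine_sum_nonneg_of_longest ha hb hc hac hbc ht (hf0 a ha) (hf0 b hb)
        (hf ha hc hac) (hf hb hc hbc) (hg0 a ha) (hg0 b hb) (hg0 c hc)
  by_cases hxz : x ≤ z
  · by_cases hyz : y ≤ z
    · exact key hx hy hz hxz hyz hzt
    · linear_combination key hx hz hy (by linarith) (by linarith) hyt
  · by_cases hyx : y ≤ x
    · linear_combination key hy hz hx hyx (by linarith) hxt
    · linear_combination key hx hz hy (by linarith) (by linarith) hyt

lemma inner_sub_sub_eq_norm_sq {E : Type*} [NormedAddCommGroup E] [InnerProductSpace ℝ E]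
    (p u v : E) :
    ⟪p - u, p - v⟫ = (‖p - u‖ ^ 2 + ‖p - v‖ ^ 2 - ‖u - v‖ ^ 2) / 2 := by
  have h := norm_sub_sq_real (p - u) (p - v)
  rw [sub_sub_sub_cancel_left, norm_sub_rev] at h
  linarith

lemma triangle_sum_inner_nonneg {E : Type*} [NormedAddCommGroup E] [InnerProductSpace ℝ E]
    {a b : ℝ → ℝ} (ha : MonotoneOn (fun t => a t * t) (Set.Ioi 0))
    (ha0 : ∀ t, 0 < t → 0 ≤ a t) (hb0 : ∀ t, 0 < t → 0 ≤ b t) {p u v : E}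
    (hpu : p ≠ u) (hpv : p ≠ v) (huv : u ≠ v) :
    0 ≤ (a ‖p - u‖ * b ‖p - v‖ + a ‖p - v‖ * b ‖p - u‖) * ⟪p - u, p - v⟫
      + (a ‖u - p‖ * b ‖u - v‖ + a ‖u - v‖ * b ‖u - p‖) * ⟪u - p, u - v⟫
      + (a ‖v - p‖ * b ‖v - u‖ + a ‖v - u‖ * b ‖v - p‖) * ⟪v - p, v - u⟫ := by
  simp only [inner_sub_sub_eq_norm_sq]
  rw [norm_sub_rev u p, norm_sub_rev v p, norm_sub_rev v u]
  have hx : 0 < ‖u - v‖ := norm_sub_pos_iff.2 huv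
  have hy : 0 < ‖p - v‖ := norm_sub_pos_iff.2 hpv
  have hz : 0 < ‖p - u‖ := norm_sub_pos_iff.2 hpu
  have hxt : ‖u - v‖ ≤ ‖p - v‖ + ‖p - u‖ := by
    have := norm_sub_le_norm_sub_add_norm_sub u p v
    rw [norm_sub_rev u p] at this
    linarith
  have hyt : ‖p - v‖ ≤ ‖u - v‖ + ‖p - u‖ := by
    linarith [norm_sub_le_norm_sub_add_norm_sub p u v]
  have hzt : ‖p - u‖ ≤ ‖u - v‖ + ‖p - v‖ := by
    have := norm_sub_le_norm_sub_add_norm_sub p v u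
    rw [norm_sub_rev v u] at this
    linarith
  have h := weighted_cosine_sum_nonneg (g := fun t => b t * t) ha
    (fun t ht => mul_nonneg (ha0 t ht) ht.le) (fun t ht => mul_nonneg (hb0 t ht) ht.le)
    hx hy hz hxt hyt hzt
  refine nonneg_of_mul_nonneg_right (a := 2 * (‖u - v‖ * ‖p - v‖ * ‖p - u‖)) ?_ (by positivity)
  linear_combination h

lemma sum_nonneg_of_symmetrization_nonneg {ι : Type*} [Fintype ι] (T : ι → ι → ι → ℝ)
    (hT : ∀ i j k, 0 ≤ T i j k + T i k j + (T j i k + T j k i) + (T k i j + T k j i)) :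
    0 ≤ ∑ i, ∑ j, ∑ k, T i j k := by
  have h : 0 ≤ ∑ i, ∑ j, ∑ k,
      (T i j k + T i k j + (T j i k + T j k i) + (T k i j + T k j i)) :=
    Finset.sum_nonneg fun i _ => Finset.sum_nonneg fun j _ => Finset.sum_nonneg fun k _ => hT i j k
  simp only [Finset.sum_add_distrib] at h
  have swap (F : ι → ι → ι → ℝ) : ∑ i, ∑ j, ∑ k, F i k j = ∑ i, ∑ j, ∑ k, F i j k :=
    Finset.sum_congr rfl fun i _ => Finset.sum_comm
  have swap' (F : ι → ι → ι → ℝ) : ∑ i, ∑ j, ∑ k, F j i k = ∑ i, ∑ j, ∑ k, F i j k :=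
    Finset.sum_comm
  have e1 := swap T
  have e2 := swap' T
  have e3 : ∑ i, ∑ j, ∑ k, T j k i = ∑ i, ∑ j, ∑ k, T i j k :=
    (swap' fun i j k => T i k j).trans e1
  have e4 : ∑ i, ∑ j, ∑ k, T k i j = ∑ i, ∑ j, ∑ k, T i j k :=
    (swap fun i j k => T j i k).trans e2
  have e5 : ∑ i, ∑ j, ∑ k, T k j i = ∑ i, ∑ j, ∑ k, T i j k :=
    (swap fun i j k => T j k i).trans e3
  linarith

lemma sum_sum_ne_eq_two_mul_sum_lt {ι : Type*} [Fintype ι] [LinearOrder ι] (D : ι → ι → ℝ)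
    (hD : ∀ i j, D i j = D j i) :
    ∑ i, ∑ j ∈ Finset.univ.filter (fun j => j ≠ i), D i j
      = 2 * ∑ i, ∑ j ∈ Finset.univ.filter (fun j => i < j), D i j := by
  have h1 : ∑ i, ∑ j ∈ Finset.univ.filter (fun j => j ≠ i), D i j
      = ∑ i, ∑ j ∈ Finset.univ.filter (fun j => i < j), D i j
        + ∑ i, ∑ j ∈ Finset.univ.filter (fun j => j < i), D i j := by
    simp only [Finset.sum_filter, ← Finset.sum_add_distrib]
    refine Finset.sum_congr rfl fun i _ => Finset.sum_congr rfl fun j _ => ?_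
    rcases lt_trichotomy i j with h | rfl | h
    · simp [h, h.ne', h.not_gt]
    · simp
    · simp [h, h.ne, h.not_gt]
  have h2 : ∑ i, ∑ j ∈ Finset.univ.filter (fun j => j < i), D i j
      = ∑ i, ∑ j ∈ Finset.univ.filter (fun j => i < j), D i j := by
    simp only [Finset.sum_filter]
    rw [Finset.sum_comm]
    exact Finset.sum_congr rfl fun i _ => Finset.sum_congr rfl fun j _ => by rw [hD]
  linarith

/-- The off-diagonal part of the double sum of interactions is nonnegative. -/
lemma sum_diagonal_le_sum_inner {ι E : Type*} [Fintype ι] [DecidableEq ι]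
    [NormedAddCommGroup E] [InnerProductSpace ℝ E] {a b : ℝ → ℝ}
    (ha : MonotoneOn (fun t => a t * t) (Set.Ioi 0))
    (ha0 : ∀ t, 0 < t → 0 ≤ a t) (hb0 : ∀ t, 0 < t → 0 ≤ b t)
    {q : ι → E} (hq : Function.Injective q) :
    ∑ i, ∑ j ∈ Finset.univ.filter (fun j => j ≠ i),
        a ‖q i - q j‖ * b ‖q i - q j‖ * ‖q i - q j‖ ^ 2
      ≤ ∑ i, ⟪(∑ j ∈ Finset.univ.filter (fun j => j ≠ i), a ‖q i - q j‖ • (q i - q j)),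
          (∑ k ∈ Finset.univ.filter (fun k => k ≠ i), b ‖q i - q k‖ • (q i - q k))⟫ := by
  set G : ι → ι → ι → ℝ := fun i j k =>
    a ‖q i - q j‖ * b ‖q i - q k‖ * ⟪q i - q j, q i - q k⟫ with hG
  have drop (c : ℝ → ℝ) (i : ι) :
      ∑ j ∈ Finset.univ.filter (fun j => j ≠ i), c ‖q i - q j‖ • (q i - q j)
        = ∑ j, c ‖q i - q j‖ • (q i - q j) := by
    refine Finset.sum_filter_of_ne fun j _ hj => ?_
    rintro rfl
    simp at hj
  have hL : ∑ i, ∑ j ∈ Finset.univ.filter (fun j => j ≠ i),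
        a ‖q i - q j‖ * b ‖q i - q j‖ * ‖q i - q j‖ ^ 2 = ∑ i, ∑ j, G i j j := by
    refine Finset.sum_congr rfl fun i _ => ?_
    simp only [hG, real_inner_self_eq_norm_sq]
    refine Finset.sum_filter_of_ne fun j _ hj => ?_
    rintro rfl
    simp at hj
  have hR : ∑ i, ⟪(∑ j ∈ Finset.univ.filter (fun j => j ≠ i), a ‖q i - q j‖ • (q i - q j)),
        (∑ k ∈ Finset.univ.filter (fun k => k ≠ i), b ‖q i - q k‖ • (q i - q k))⟫
      = ∑ i, ∑ j, ∑ k, G i j k := by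
    refine Finset.sum_congr rfl fun i _ => ?_
    rw [drop, drop, sum_inner]
    refine Finset.sum_congr rfl fun j _ => ?_
    rw [inner_sum]
    refine Finset.sum_congr rfl fun k _ => ?_
    rw [real_inner_smul_left, real_inner_smul_right, ← mul_assoc]
  have hT := sum_nonneg_of_symmetrization_nonneg
    (fun i j k => G i j k - if j = k then G i j k else 0) (fun i j k => by
      by_cases hij : i = j
      · subst hij; simp [hG]
      by_cases hik : i = k
      · subst hik; simp [hG]
      by_cases hjk : j = k
      · subst hjk; simp [hG]
      have h := triangle_sum_inner_nonneg ha ha0 hb0 (hq.ne hij) (hq.ne hik) (hq.ne hjk)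
      simp only [hij, hik, hjk, Ne.symm hij, Ne.symm hik, Ne.symm hjk, if_false, sub_zero, hG]
      rw [real_inner_comm (q i - q j) (q i - q k), real_inner_comm (q j - q i) (q j - q k),
        real_inner_comm (q k - q i) (q k - q j)]
      linear_combination h)
  simp only [Finset.sum_sub_distrib, Finset.sum_ite_eq, Finset.mem_univ, if_true] at hT
  rw [hL, hR]
  linarith

/-- Lemma A.1: for pairwise distinct `q i` in `ℝ^d`, `γ ∈ (0,1]` and `s ≥ 0`,
`∑ i ⟨∑_{j≠i} (qᵢ−qⱼ)/|qᵢ−qⱼ|^γ, ∑_{k≠i} (qᵢ−qₖ)/|qᵢ−qₖ|^{s+1}⟩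
  ≥ 2 ∑_{i<j} 1/|qᵢ−qⱼ|^{s+γ−1}`. -/
theorem stmt_0 (d N : ℕ) (hd : 1 ≤ d) (hN : 1 ≤ N)
    (q : Fin N → EuclideanSpace ℝ (Fin d)) (hq : Function.Injective q)
    (γ s : ℝ) (hγ0 : 0 < γ) (hγ1 : γ ≤ 1) (hs : 0 ≤ s) :
    2 * ∑ i : Fin N, ∑ j ∈ Finset.univ.filter (fun j => i < j),
        (‖q i - q j‖ ^ (s + γ - 1))⁻¹
      ≤ ∑ i : Fin N,
          ⟪(∑ j ∈ Finset.univ.filter (fun j => j ≠ i), (‖q i - q j‖ ^ γ)⁻¹ • (q i - q j)),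
            (∑ k ∈ Finset.univ.filter (fun k => k ≠ i),
              (‖q i - q k‖ ^ (s + 1))⁻¹ • (q i - q k))⟫ := by
  have ha : MonotoneOn (fun t : ℝ => (t ^ γ)⁻¹ * t) (Set.Ioi 0) := by
    have hpow : ∀ t : ℝ, 0 < t → (t ^ γ)⁻¹ * t = t ^ (1 - γ) := fun t ht => by
      rw [Real.rpow_sub ht, Real.rpow_one, div_eq_inv_mul]
    intro x hx y hy hxy
    simp only [hpow x hx, hpow y hy]
    exact Real.rpow_le_rpow (le_of_lt hx) hxy (by linarith)
  refine le_trans (le_of_eq ?_) (sum_diagonal_le_sum_inner (a := fun t => (t ^ γ)⁻¹)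
    (b := fun t => (t ^ (s + 1))⁻¹) ha (fun t ht => by positivity) (fun t ht => by positivity) hq)
  rw [← sum_sum_ne_eq_two_mul_sum_lt _ fun i j => by rw [norm_sub_rev]]
  refine Finset.sum_congr rfl fun i _ => Finset.sum_congr rfl fun j hj => ?_
  have hpos : 0 < ‖q i - q j‖ :=
    norm_sub_pos_iff.2 (hq.ne (Finset.mem_filter.1 hj).2.symm)
  rw [← Real.rpow_neg hpos.le, ← Real.rpow_neg hpos.le, ← Real.rpow_neg hpos.le,
    ← Real.rpow_natCast, ← Real.rpow_add hpos, ← Real.rpow_add hpos]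
  congr 1
  push_cast
  ring
end

section
/- Let d ≥ 1, γ ∈ (0,1], s ≥ 0, and let x, y, z ∈ ℝ^d be pairwise distinct. Then ⟨(x−y)/|x−y|^γ, (x−z)/|x−z|^{s+1}⟩ + ⟨(x−z)/|x−z|^γ, (x−y)/|x−y|^{s+1}⟩ + ⟨(y−x)/|y−x|^γ, (y−z)/|y−z|^{s+1}⟩ + ⟨(y−z)/|y−z|^γ, (y−x)/|y−x|^{s+1}⟩ + ⟨(z−x)/|z−x|^γ, (z−y)/|z−y|^{s+1}⟩ + ⟨(z−y)/|z−y|^γ, (z−x)/|z−x|^{s+1}⟩ ≥ 0. (Key three-point claim A_{ijk} ≥ 0 in the proof of Lemma A.1) -/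
open scoped RealInnerProductSpace

/-- Pairing of two angles of a triangle with sides `a ≥ b` and `c`: the sum of their weighted
cosines is nonnegative when the weight of the longer side, multiplied by its length, dominates. -/
lemma weighted_cosine_pair_nonneg {a b c p q : ℝ} (ha : 0 < a) (hb : 0 < b) (hba : b ≤ a)
    (hc : a ≤ b + c) (hq : 0 ≤ q) (hpq : b * q ≤ a * p) :
    0 ≤ (a ^ 2 + c ^ 2 - b ^ 2) * p + (b ^ 2 + c ^ 2 - a ^ 2) * q := by
  have h₁ : 0 ≤ (a + b) * (c ^ 2 - (a - b) ^ 2) :=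
    mul_nonneg (by linarith) (by nlinarith)
  have h₂ : 0 ≤ a ^ 2 + c ^ 2 - b ^ 2 := by nlinarith [sq_nonneg c]
  have h₃ := mul_le_mul_of_nonneg_left hpq h₂
  have h₄ := mul_nonneg h₁ hq
  refine nonneg_of_mul_nonneg_right (a := a) ?_ ha
  linarith

/-- The three-point inequality in terms of side lengths, when `a` is the longest side. -/
lemma weighted_cosine_sum_nonneg_of_longest_s1 {F G : ℝ → ℝ} (hF : ∀ t, 0 < t → 0 ≤ F t)
    (hG : ∀ t, 0 < t → 0 ≤ G t) (hmono : ∀ t u, 0 < t → t ≤ u → t * F t ≤ u * F u)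
    {a b c : ℝ} (ha : 0 < a) (hb : 0 < b) (hc : 0 < c) (hba : b ≤ a) (hca : c ≤ a)
    (habc : a ≤ b + c) :
    0 ≤ (b ^ 2 + c ^ 2 - a ^ 2) * (F c * G b + F b * G c)
      + (a ^ 2 + c ^ 2 - b ^ 2) * (F c * G a + F a * G c)
      + (a ^ 2 + b ^ 2 - c ^ 2) * (F a * G b + F b * G a) := by
  have h₁ := mul_nonneg
    (weighted_cosine_pair_nonneg ha hb hba habc (hF b hb) (hmono b a hb hba)) (hG c hc)
  have h₂ := mul_nonneg
    (weighted_cosine_pair_nonneg (c := b) ha hc hca (by linarith) (hF c hc) (hmono c a hc hca)) (hG b hb)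
  have h₃ : 0 ≤ (a ^ 2 + c ^ 2 - b ^ 2) * (F c * G a) :=
    mul_nonneg (by nlinarith) (mul_nonneg (hF c hc) (hG a ha))
  have h₄ : 0 ≤ (a ^ 2 + b ^ 2 - c ^ 2) * (F b * G a) :=
    mul_nonneg (by nlinarith) (mul_nonneg (hF b hb) (hG a ha))
  linarith

/-- The three-point inequality in terms of the side lengths of an arbitrary triangle. -/
lemma weighted_cosine_sum_nonneg_s1 {F G : ℝ → ℝ} (hF : ∀ t, 0 < t → 0 ≤ F t)
    (hG : ∀ t, 0 < t → 0 ≤ G t) (hmono : ∀ t u, 0 < t → t ≤ u → t * F t ≤ u * F u)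
    {a b c : ℝ} (ha : 0 < a) (hb : 0 < b) (hc : 0 < c)
    (habc : a ≤ b + c) (hbac : b ≤ a + c) (hcab : c ≤ a + b) :
    0 ≤ (b ^ 2 + c ^ 2 - a ^ 2) * (F c * G b + F b * G c)
      + (a ^ 2 + c ^ 2 - b ^ 2) * (F c * G a + F a * G c)
      + (a ^ 2 + b ^ 2 - c ^ 2) * (F a * G b + F b * G a) := by
  have key := @weighted_cosine_sum_nonneg_of_longest_s1 F G hF hG hmono
  rcases le_total b a with hba | hab
  · rcases le_total c a with hca | hac
    · exact key ha hb hc hba hca habc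
    · linarith [key hc ha hb hac (hba.trans hac) hcab]
  · rcases le_total c b with hcb | hbc
    · linarith [key hb ha hc hab hcb hbac]
    · linarith [key hc ha hb (hab.trans hbc) hbc hcab]

lemma real_inner_sub_sub_eq_norm_sq {E : Type*} [NormedAddCommGroup E] [InnerProductSpace ℝ E]
    (x y z : E) :
    ⟪x - y, x - z⟫ = (‖x - y‖ ^ 2 + ‖x - z‖ ^ 2 - ‖y - z‖ ^ 2) / 2 := by
  have h := norm_sub_sq_real (x - y) (x - z)
  rw [sub_sub_sub_cancel_left, norm_sub_rev z y] at h
  linarith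

lemma mul_inv_rpow_le_mul_inv_rpow {γ t u : ℝ} (hγ : γ ≤ 1) (ht : 0 < t) (htu : t ≤ u) :
    t * (t ^ γ)⁻¹ ≤ u * (u ^ γ)⁻¹ := by
  have h : ∀ v : ℝ, 0 < v → v * (v ^ γ)⁻¹ = v ^ (1 - γ) := fun v hv => by
    rw [Real.rpow_sub hv, Real.rpow_one, div_eq_mul_inv]
  rw [h t ht, h u (ht.trans_le htu)]
  exact Real.rpow_le_rpow ht.le htu (by linarith)

/-- Three-point claim `A_{ijk} ≥ 0` in the proof of Lemma A.1: for pairwise distinct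
`x, y, z ∈ ℝ^d`, `γ ∈ (0,1]` and `s ≥ 0`, the six cross inner products sum to a
nonnegative quantity. -/
theorem stmt_1 (d : ℕ) (hd : 1 ≤ d) (γ s : ℝ) (hγ0 : 0 < γ) (hγ1 : γ ≤ 1) (hs : 0 ≤ s)
    (x y z : EuclideanSpace ℝ (Fin d)) (hxy : x ≠ y) (hxz : x ≠ z) (hyz : y ≠ z) :
    0 ≤ ⟪(‖x - y‖ ^ γ)⁻¹ • (x - y), (‖x - z‖ ^ (s + 1))⁻¹ • (x - z)⟫
      + ⟪(‖x - z‖ ^ γ)⁻¹ • (x - z), (‖x - y‖ ^ (s + 1))⁻¹ • (x - y)⟫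
      + ⟪(‖y - x‖ ^ γ)⁻¹ • (y - x), (‖y - z‖ ^ (s + 1))⁻¹ • (y - z)⟫
      + ⟪(‖y - z‖ ^ γ)⁻¹ • (y - z), (‖y - x‖ ^ (s + 1))⁻¹ • (y - x)⟫
      + ⟪(‖z - x‖ ^ γ)⁻¹ • (z - x), (‖z - y‖ ^ (s + 1))⁻¹ • (z - y)⟫
      + ⟪(‖z - y‖ ^ γ)⁻¹ • (z - y), (‖z - x‖ ^ (s + 1))⁻¹ • (z - x)⟫ := by
  have main := weighted_cosine_sum_nonneg_s1 (F := fun t => (t ^ γ)⁻¹)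
    (G := fun t => (t ^ (s + 1))⁻¹) (fun t ht => by positivity) (fun t ht => by positivity)
    (fun t u => mul_inv_rpow_le_mul_inv_rpow hγ1)
    (norm_sub_pos_iff.2 hyz) (norm_sub_pos_iff.2 hxz) (norm_sub_pos_iff.2 hxy)
    (by linarith [norm_sub_le_norm_sub_add_norm_sub y x z, norm_sub_rev x y])
    (by linarith [norm_sub_le_norm_sub_add_norm_sub x y z])
    (by linarith [norm_sub_le_norm_sub_add_norm_sub x z y, norm_sub_rev y z])
  simp only [real_inner_smul_left, real_inner_smul_right, real_inner_sub_sub_eq_norm_sq,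
    norm_sub_rev y x, norm_sub_rev z x, norm_sub_rev z y] at main ⊢
  linarith
end

section
/- Let d ≥ 1, N ≥ 2, and assume Assumptions (U) and (G1) together with the normalization ∑_{i=1}^N U(qᵢ) + ∑_{1≤i<j≤N} G(qᵢ−qⱼ) ≥ 1 for all q ∈ D. Then there exist positive constants c_G (small) and C_G (large), independent of q, such that for all q = (q₁,…,q_N) ∈ D: C_G[∑_{i=1}^N U(qᵢ) + ∑_{1≤i<j≤N} G(qᵢ−qⱼ)] ≥ ∑_{i=1}^N |qᵢ| − c_G ∑_{1≤i<j≤N} log|qᵢ−qⱼ| ≥ c_G ∑_{i=1}^N |qᵢ| + c_G · max{−log|qᵢ−qⱼ| : 1 ≤ i < j ≤ N}. (Lemma A.2) -/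
open scoped RealInnerProductSpace

theorem exists_abs_mul_rpow_le {ε b β₁ β₂ : ℝ} (hε : 0 < ε) (hβ₂ : 0 ≤ β₂) (hβ : β₂ < β₁) :
    ∃ K : ℝ, 0 ≤ K ∧ ∀ t : ℝ, 0 < t → |b| * t ^ β₂ ≤ ε * t ^ β₁ + K := by
  obtain ⟨s, hs⟩ := Filter.eventually_atTop.1
    ((tendsto_rpow_atTop (sub_pos.2 hβ)).eventually_ge_atTop (|b| / ε))
  have hb := abs_nonneg b
  refine ⟨|b| * max s 0 ^ β₂, by positivity, fun t ht => ?_⟩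
  rcases le_total t s with h | h
  · have h1 : t ^ β₂ ≤ max s 0 ^ β₂ :=
      Real.rpow_le_rpow ht.le (h.trans (le_max_left _ _)) hβ₂
    have h2 : 0 ≤ ε * t ^ β₁ := by positivity
    nlinarith [mul_le_mul_of_nonneg_left h1 hb]
  · have h1 := (div_le_iff₀ hε).1 (hs t h)
    have h2 : t ^ β₁ = t ^ (β₁ - β₂) * t ^ β₂ := by
      rw [← Real.rpow_add ht]; congr 1; ring
    have h3 : 0 ≤ |b| * max s 0 ^ β₂ := by positivity
    have h4 : 0 ≤ t ^ β₂ := by positivity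
    rw [h2]
    nlinarith [mul_le_mul_of_nonneg_right h1 h4]

theorem exists_mul_le_rpow_div {a p : ℝ} (ha : 0 < a) (hp : 2 ≤ p) (M : ℝ) :
    ∃ K : ℝ, 0 ≤ K ∧ ∀ x : ℝ, 0 ≤ x → M * x ≤ 1 / a * x ^ p + K := by
  refine ⟨1 / a * (1 + (a * M) ^ 2), by positivity, fun x hx => ?_⟩
  have h : x ^ 2 ≤ x ^ p + 1 := by
    rcases le_total x 1 with h | h
    · have : 0 ≤ x ^ p := by positivity
      nlinarith
    · have := Real.rpow_le_rpow_of_exponent_le h hp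
      rw [Real.rpow_two] at this
      linarith
  have h1 : a * M * x ≤ x ^ p + (1 + (a * M) ^ 2) := by
    nlinarith [sq_nonneg (x - a * M), sq_nonneg x, sq_nonneg (a * M)]
  calc M * x = 1 / a * (a * M * x) := by field_simp
    _ ≤ 1 / a * (x ^ p + (1 + (a * M) ^ 2)) := by gcongr
    _ = _ := by ring

theorem inner_gradient_le_of_norm_add_le {E : Type*} [NormedAddCommGroup E]
    [InnerProductSpace ℝ E] {v u : E} {r a b c β₁ β₂ : ℝ} (hr : 0 < r) (hu : ‖u‖ = 1)
    (h : ‖v + (a / ‖r • u‖ ^ (β₁ + 1)) • (r • u) + (b / ‖r • u‖ ^ (β₂ + 1)) • (r • u)‖ ≤ c) :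
    ⟪v, u⟫ ≤ c - a * r⁻¹ ^ β₁ - b * r⁻¹ ^ β₂ := by
  have hnorm : ‖r • u‖ = r := by rw [norm_smul, hu, Real.norm_of_nonneg hr.le, mul_one]
  rw [hnorm] at h
  have hpow : ∀ a β : ℝ, a / r ^ (β + 1) * r = a * r⁻¹ ^ β := by
    intro a β
    rw [Real.rpow_add_one hr.ne', Real.inv_rpow hr.le]
    field_simp
  have h1 := (real_inner_le_norm _ u).trans (mul_le_mul_of_nonneg_right h (norm_nonneg u))
  rw [inner_add_left, inner_add_left, smul_smul, smul_smul, inner_smul_left, inner_smul_left,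
    real_inner_self_eq_norm_sq, hu] at h1
  simp only [hpow, conj_trivial, one_pow, mul_one] at h1
  linarith

theorem exists_singular_lower_bound {E : Type*} [NormedAddCommGroup E]
    [InnerProductSpace ℝ E] [CompleteSpace E] {G : E → ℝ} {a₁ β₁ β₂ a₄ a₅ a₆ : ℝ}
    (ha₁ : 0 < a₁) (hβ₁ : 1 ≤ β₁) (hβ₂ : 0 ≤ β₂) (hβ : β₂ < β₁) (ha₄ : 0 < a₄) (ha₆ : 0 < a₆)
    (hdiff : ∀ q, q ≠ 0 → DifferentiableAt ℝ G q)
    (hbd : ∀ q, q ≠ 0 → |G q| ≤ a₁ * (1 + ‖q‖ + ‖q‖ ^ (-β₁)))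
    (hstruct : ∀ q, q ≠ 0 →
      ‖gradient G q + (a₄ / ‖q‖ ^ (β₁ + 1)) • q + (a₅ / ‖q‖ ^ (β₂ + 1)) • q‖ ≤ a₆) :
    ∃ A B : ℝ, 0 < A ∧ 0 ≤ B ∧
      ∀ q, q ≠ 0 → -(A * Real.log ‖q‖) - B * (1 + ‖q‖) ≤ G q := by
  obtain ⟨K, hK, hKt⟩ := exists_abs_mul_rpow_le (b := a₅) (half_pos ha₄) hβ₂ hβ
  refine ⟨a₄ / 2, 3 * a₁ + (K + a₆), by positivity, by positivity, fun q hq => ?_⟩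
  have hq0 : 0 < ‖q‖ := norm_pos_iff.2 hq
  rcases le_total 1 ‖q‖ with h1 | h1
  · have h2 : ‖q‖ ^ (-β₁) ≤ 1 := Real.rpow_le_one_of_one_le_of_nonpos h1 (by linarith)
    have h3 := (abs_le.1 (hbd q hq)).1
    have h4 := Real.log_nonneg h1
    have h5 : 0 ≤ a₄ / 2 * Real.log ‖q‖ := by positivity
    nlinarith [mul_le_mul_of_nonneg_left h2 ha₁.le, mul_nonneg ha₁.le hq0.le,
      mul_nonneg (add_nonneg hK ha₆.le) hq0.le]
  set u : E := ‖q‖⁻¹ • q with hu_def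
  have hu : ‖u‖ = 1 := by rw [hu_def, norm_smul, norm_inv, norm_norm, inv_mul_cancel₀ hq0.ne']
  have hu0 : u ≠ 0 := norm_ne_zero_iff.1 (by simp [hu])
  have hqu : ‖q‖ • u = q := by rw [hu_def, smul_smul, mul_inv_cancel₀ hq0.ne', one_smul]
  have hderiv : ∀ r : ℝ, 0 < r → HasDerivAt
      (fun r : ℝ => G (r • u) + a₄ / 2 * Real.log r - (K + a₆) * r)
      (⟪gradient G (r • u), u⟫ + a₄ / 2 * r⁻¹ - (K + a₆) * 1) r := by
    intro r hr
    have hG := (hdiff (r • u) (smul_ne_zero hr.ne' hu0)).hasGradientAt.hasFDerivAt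
    have hl : HasDerivAt (fun r : ℝ => r • u) u r := by
      simpa using (hasDerivAt_id r).smul_const u
    have := hG.comp_hasDerivAt r hl
    rw [InnerProductSpace.toDual_apply_apply] at this
    exact (this.add ((Real.hasDerivAt_log hr.ne').const_mul _)).sub
      ((hasDerivAt_id r).const_mul _)
  have hanti : AntitoneOn (fun r : ℝ => G (r • u) + a₄ / 2 * Real.log r - (K + a₆) * r)
      (Set.Icc ‖q‖ 1) := by
    refine antitoneOn_of_deriv_nonpos (convex_Icc _ _)
      (fun r hr => (hderiv r (hq0.trans_le hr.1)).continuousAt.continuousWithinAt)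
      (fun r hr => ?_) (fun r hr => ?_) <;> rw [interior_Icc] at hr <;>
      have hr0 := hq0.trans hr.1
    · exact (hderiv r hr0).differentiableAt.differentiableWithinAt
    rw [(hderiv r hr0).deriv]
    have h2 := inner_gradient_le_of_norm_add_le hr0 hu (hstruct _ (smul_ne_zero hr0.ne' hu0))
    have hinv : 1 ≤ r⁻¹ := (one_le_inv₀ hr0).2 hr.2.le
    have h3 := hKt r⁻¹ (by positivity)
    have h4 : r⁻¹ ≤ r⁻¹ ^ β₁ := by
      simpa using Real.rpow_le_rpow_of_exponent_le hinv hβ₁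
    have h5 : 0 ≤ r⁻¹ ^ β₂ := by positivity
    nlinarith [mul_le_mul_of_nonneg_left h4 ha₄.le,
      mul_le_mul_of_nonneg_right (neg_abs_le a₅) h5]
  have h6 := hanti (Set.left_mem_Icc.2 h1) (Set.right_mem_Icc.2 h1) h1
  simp only [hqu, one_smul, Real.log_one, mul_zero, mul_one, add_zero] at h6
  have h7 := (abs_le.1 (hbd u hu0)).1
  rw [hu, Real.one_rpow] at h7
  nlinarith [mul_nonneg (add_nonneg hK ha₆.le) hq0.le, mul_nonneg ha₁.le hq0.le]

theorem sum_sum_lt_const_le (N : ℕ) {X : ℝ} (hX : 0 ≤ X) :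
    ∑ i : Fin N, ∑ _j ∈ Finset.univ.filter (fun j => i < j), X ≤ N * N * X := by
  calc ∑ i : Fin N, ∑ _j ∈ Finset.univ.filter (fun j => i < j), X
      ≤ ∑ _i : Fin N, ∑ _j : Fin N, X := by
        gcongr
        exact Finset.filter_subset _ _
    _ = N * N * X := by simp [mul_assoc]

theorem norm_sub_le_sum_norm {ι E : Type*} [Fintype ι] [SeminormedAddCommGroup E] (q : ι → E)
    {i j : ι} (hij : i ≠ j) : ‖q i - q j‖ ≤ ∑ k, ‖q k‖ := by
  classical
  calc ‖q i - q j‖ ≤ ‖q i‖ + ‖q j‖ := norm_sub_le _ _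
    _ = ∑ k ∈ {i, j}, ‖q k‖ := (Finset.sum_pair (f := fun k => ‖q k‖) hij).symm
    _ ≤ ∑ k, ‖q k‖ :=
      Finset.sum_le_univ_sum_of_nonneg fun _ => norm_nonneg _

theorem sum_norm_sub_log_lower_bound {N : ℕ} {E : Type*} [NormedAddCommGroup E] {c : ℝ}
    (hc : 0 < c) (hcN : c * (N * N) ≤ 1) (q : Fin N → E) {k l : Fin N} (hkl : k < l) :
    c * ∑ i, ‖q i‖ + c * (-Real.log ‖q k - q l‖) ≤
      ∑ i, ‖q i‖ - c * ∑ i : Fin N, ∑ j ∈ Finset.univ.filter (fun j => i < j),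
        Real.log ‖q i - q j‖ := by
  set S := ∑ i, ‖q i‖ with hS
  have hS0 : 0 ≤ S := Finset.sum_nonneg fun _ _ => norm_nonneg _
  have hF : ∀ i, ∀ j ∈ Finset.univ.filter (fun j => i < j),
      0 ≤ S - Real.log ‖q i - q j‖ := by
    intro i j hj
    have h1 := norm_sub_le_sum_norm q (Finset.mem_filter.1 hj).2.ne
    have h2 := Real.log_le_self (norm_nonneg (q i - q j))
    linarith
  have h1 : S - Real.log ‖q k - q l‖ ≤ ∑ i : Fin N,
      ∑ j ∈ Finset.univ.filter (fun j => i < j), (S - Real.log ‖q i - q j‖) :=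
    (Finset.single_le_sum (hF k) (by simpa using hkl)).trans
      (Finset.single_le_sum
        (f := fun i => ∑ j ∈ Finset.univ.filter (fun j => i < j), (S - Real.log ‖q i - q j‖))
        (fun i _ => Finset.sum_nonneg (hF i)) (Finset.mem_univ k))
  simp only [Finset.sum_sub_distrib] at h1
  have h2 := sum_sum_lt_const_le N hS0
  nlinarith [mul_le_mul_of_nonneg_left (h1.trans (sub_le_sub_right h2 _)) hc.le,
    mul_le_mul_of_nonneg_right hcN hS0]

/-- Lemma A.2: under Assumptions (U) and (G1) and the normalization
`∑ U(qᵢ) + ∑_{i<j} G(qᵢ−qⱼ) ≥ 1` on `D`, there exist `c_G > 0` small and `C_G > 0` large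
such that for all `q ∈ D`:
`C_G[∑ U(qᵢ) + ∑_{i<j} G(qᵢ−qⱼ)] ≥ ∑|qᵢ| − c_G ∑_{i<j} log|qᵢ−qⱼ|
  ≥ c_G ∑|qᵢ| + c_G max{−log|qᵢ−qⱼ| : i < j}`. -/
theorem stmt_2 (d N : ℕ) (hd : 1 ≤ d) (hN : 2 ≤ N)
    (U G : EuclideanSpace ℝ (Fin d) → ℝ)
    (a₁ lam a₂ a₃ β₁ β₂ a₄ a₅ a₆ : ℝ)
    (ha₁ : 0 < a₁) (hlam : 1 ≤ lam) (ha₂ : 0 < a₂) (ha₃ : 0 < a₃)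
    (hβ₁ : 1 ≤ β₁) (hβ₂0 : 0 ≤ β₂) (hβ₂1 : β₂ < β₁) (ha₄ : 0 < a₄) (ha₆ : 0 < a₆)
    (hUsmooth : ContDiff ℝ (⊤ : ℕ∞) U)
    (hUone : ∀ q, 1 ≤ U q)
    (hUlow : ∀ q : EuclideanSpace ℝ (Fin d), (1 / a₁) * ‖q‖ ^ (lam + 1) - a₁ ≤ U q)
    (hUup : ∀ q : EuclideanSpace ℝ (Fin d), U q ≤ a₁ * (1 + ‖q‖ ^ (lam + 1)))
    (hUgrad : ∀ q : EuclideanSpace ℝ (Fin d), ‖gradient U q‖ ≤ a₁ * (1 + ‖q‖ ^ lam))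
    (hUcoer : ∀ q : EuclideanSpace ℝ (Fin d), a₂ * ‖q‖ ^ (lam + 1) - a₃ ≤ ⟪gradient U q, q⟫)
    (hGsmooth : ContDiffOn ℝ (⊤ : ℕ∞) G {(0 : EuclideanSpace ℝ (Fin d))}ᶜ)
    (hGblow : Filter.Tendsto G (nhdsWithin 0 {(0 : EuclideanSpace ℝ (Fin d))}ᶜ) Filter.atTop)
    (hGeven : ∀ q, G (-q) = G q)
    (hGodd : ∀ q : EuclideanSpace ℝ (Fin d), q ≠ 0 → gradient G (-q) = -gradient G q)
    (hGbd : ∀ q : EuclideanSpace ℝ (Fin d), q ≠ 0 →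
      |G q| ≤ a₁ * (1 + ‖q‖ + ‖q‖ ^ (-β₁)))
    (hGgradbd : ∀ q : EuclideanSpace ℝ (Fin d), q ≠ 0 →
      ‖gradient G q‖ ≤ a₁ * (1 + ‖q‖ ^ (-β₁)))
    (hGstruct : ∀ q : EuclideanSpace ℝ (Fin d), q ≠ 0 →
      ‖gradient G q + (a₄ / ‖q‖ ^ (β₁ + 1)) • q + (a₅ / ‖q‖ ^ (β₂ + 1)) • q‖ ≤ a₆)
    (hNorm : ∀ q : Fin N → EuclideanSpace ℝ (Fin d), Function.Injective q →
      1 ≤ ∑ i, U (q i) +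
          ∑ i : Fin N, ∑ j ∈ Finset.univ.filter (fun j => i < j), G (q i - q j)) :
    ∃ cG CG : ℝ, 0 < cG ∧ 0 < CG ∧
      ∀ q : Fin N → EuclideanSpace ℝ (Fin d), Function.Injective q →
        (∑ i, ‖q i‖ -
            cG * ∑ i : Fin N, ∑ j ∈ Finset.univ.filter (fun j => i < j),
              Real.log ‖q i - q j‖
          ≤ CG * (∑ i, U (q i) +
              ∑ i : Fin N, ∑ j ∈ Finset.univ.filter (fun j => i < j), G (q i - q j))) ∧
        (∀ k l : Fin N, k < l →
          cG * ∑ i, ‖q i‖ + cG * (-Real.log ‖q k - q l‖)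
            ≤ ∑ i, ‖q i‖ -
                cG * ∑ i : Fin N, ∑ j ∈ Finset.univ.filter (fun j => i < j),
                  Real.log ‖q i - q j‖) := by
  obtain ⟨A, B, hA, hB, hG⟩ := exists_singular_lower_bound ha₁ hβ₁ hβ₂0 hβ₂1 ha₄ ha₆
    (fun q hq => (hGsmooth.contDiffAt (isOpen_compl_singleton.mem_nhds hq)).differentiableAt
      (by simp)) hGbd hGstruct
  have hNpos : (0 : ℝ) < N := by exact_mod_cast (by omega : 0 < N)
  set c : ℝ := 1 / (N * N) with hc
  have hc0 : 0 < c := by positivity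
  obtain ⟨K, hK, hKx⟩ := exists_mul_le_rpow_div ha₁ (by linarith : 2 ≤ lam + 1)
    (A / c + N * N * B)
  set K' : ℝ := N * (K + a₁) + N * N * B with hK'
  have hK'0 : 0 ≤ K' := by positivity
  refine ⟨c, c / A * (1 + K'), hc0, by positivity, fun q hq =>
    ⟨?_, fun k l hkl => sum_norm_sub_log_lower_bound hc0 ((one_div_mul_cancel (by positivity)).le) q hkl⟩⟩
  have hH := hNorm q hq
  set S := ∑ i, ‖q i‖ with hS
  set L := ∑ i : Fin N, ∑ j ∈ Finset.univ.filter (fun j => i < j), Real.log ‖q i - q j‖ with hL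
  have hS0 : 0 ≤ S := Finset.sum_nonneg fun _ _ => norm_nonneg _
  have hUsum : (A / c + N * N * B) * S - N * (K + a₁) ≤ ∑ i, U (q i) := by
    calc (A / c + N * N * B) * S - N * (K + a₁)
        = ∑ i, ((A / c + N * N * B) * ‖q i‖ - (K + a₁)) := by
          simp [Finset.sum_sub_distrib, Finset.mul_sum, hS, mul_add]
      _ ≤ ∑ i, U (q i) := by
          gcongr with i
          linarith [hKx ‖q i‖ (norm_nonneg _), hUlow (q i)]
  have hGsum : -(A * L) - N * N * (B * (1 + S)) ≤
      ∑ i : Fin N, ∑ j ∈ Finset.univ.filter (fun j => i < j), G (q i - q j) := by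
    calc -(A * L) - N * N * (B * (1 + S))
        ≤ -(A * L) - ∑ i : Fin N, ∑ j ∈ Finset.univ.filter (fun j => i < j), B * (1 + S) :=
          sub_le_sub_left (sum_sum_lt_const_le N (by positivity)) _
      _ = ∑ i : Fin N, ∑ j ∈ Finset.univ.filter (fun j => i < j),
            (-(A * Real.log ‖q i - q j‖) - B * (1 + S)) := by
          simp only [Finset.sum_sub_distrib, Finset.sum_neg_distrib, Finset.mul_sum, hL]
      _ ≤ _ := by
          refine Finset.sum_le_sum fun i _ => Finset.sum_le_sum fun j hj => ?_
          have hij := (Finset.mem_filter.1 hj).2.ne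
          have h1 := norm_sub_le_sum_norm q hij
          have h2 := hG _ (sub_ne_zero.2 (hq.ne hij))
          linarith [mul_le_mul_of_nonneg_left h1 hB]
  set H := ∑ i, U (q i) +
    ∑ i : Fin N, ∑ j ∈ Finset.univ.filter (fun j => i < j), G (q i - q j) with hHdef
  have hlow : A / c * S - A * L ≤ (1 + K') * H := by
    nlinarith [mul_le_mul_of_nonneg_left hH hK'0]
  calc S - c * L = c / A * (A / c * S - A * L) := by field_simp
    _ ≤ c / A * ((1 + K') * H) := by gcongr
    _ = c / A * (1 + K') * H := by ring
end

section
/- Let d ≥ 1 and assume Assumption (G1). Then there exist positive constants c̃_G and C̃_G such that for all q ∈ ℝ^d ∖ {0}: G(q) + C̃_G(|q| + 1) ≥ −c̃_G · log|q|. (Inequality (A.2) in the proof of Lemma A.2) -/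
open scoped RealInnerProductSpace

/-- A power singularity of higher order dominates one of lower order near zero, up to a constant. -/
theorem exists_mul_rpow_neg_le_add {b ε β γ : ℝ} (hb : 0 ≤ b) (hε : 0 < ε) (hγ : 0 ≤ γ)
    (hγβ : γ < β) :
    ∃ K : ℝ, 0 ≤ K ∧ ∀ r : ℝ, 0 < r → b * r ^ (-γ) ≤ ε * r ^ (-β) + K := by
  have hη : 0 < ε / (b + 1) := by positivity
  set δ := (ε / (b + 1)) ^ (β - γ)⁻¹ with hδ
  have hδ0 : 0 < δ := Real.rpow_pos_of_pos hη _
  refine ⟨b * δ ^ (-γ), by positivity, fun r hr => ?_⟩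
  rcases le_total r δ with h | h
  · have hpow : r ^ (β - γ) ≤ ε / (b + 1) := by
      calc r ^ (β - γ) ≤ δ ^ (β - γ) := Real.rpow_le_rpow hr.le h (by linarith)
        _ = ε / (b + 1) := Real.rpow_inv_rpow hη.le (by linarith)
    have hsplit : r ^ (-γ) = r ^ (β - γ) * r ^ (-β) := by
      rw [← Real.rpow_add hr]; congr 1; ring
    have hle : b * r ^ (β - γ) ≤ ε := by
      rw [le_div_iff₀ (by positivity)] at hpow
      nlinarith [Real.rpow_nonneg hr.le (β - γ)]
    have hfst : b * r ^ (-γ) ≤ ε * r ^ (-β) := by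
      rw [hsplit, ← mul_assoc]
      gcongr
    have : 0 ≤ b * δ ^ (-γ) := by positivity
    linarith
  · have : r ^ (-γ) ≤ δ ^ (-γ) := Real.rpow_le_rpow_of_nonpos hδ0 h (by linarith)
    have h1 : b * r ^ (-γ) ≤ b * δ ^ (-γ) := by gcongr
    have : 0 ≤ ε * r ^ (-β) := by positivity
    linarith

/-- The radial derivative of a function is the inner product of its gradient with the direction. -/
theorem hasDerivAt_comp_smul {E : Type*} [NormedAddCommGroup E] [InnerProductSpace ℝ E]
    [CompleteSpace E] {f : E → ℝ} {u : E} {t : ℝ} (hf : DifferentiableAt ℝ f (t • u)) :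
    HasDerivAt (fun s : ℝ => f (s • u)) (inner ℝ (gradient f (t • u)) u) t := by
  have hline : HasDerivAt (fun s : ℝ => s • u) u t := by
    simpa using (hasDerivAt_id t).smul_const u
  have h := hf.hasGradientAt.hasFDerivAt.comp_hasDerivAt t hline
  rwa [InnerProductSpace.toDual_apply_apply] at h

/-- If the gradient is, up to a bounded error, a combination of radial powers, then so is the
radial derivative. -/
theorem inner_gradient_le_of_norm_le {E : Type*} [NormedAddCommGroup E] [InnerProductSpace ℝ E]
    {v u : E} {t β γ a b c : ℝ} (ht : 0 < t) (hu : ‖u‖ = 1)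
    (h : ‖v + (a / ‖t • u‖ ^ (β + 1)) • (t • u) + (b / ‖t • u‖ ^ (γ + 1)) • (t • u)‖ ≤ c) :
    inner ℝ v u ≤ c - a * t ^ (-β) - b * t ^ (-γ) := by
  have hcoef : ∀ x δ : ℝ, x / ‖t • u‖ ^ (δ + 1) * t = x * t ^ (-δ) := by
    intro x δ
    rw [norm_smul, hu, mul_one, Real.norm_of_nonneg ht.le, Real.rpow_add_one ht.ne',
      Real.rpow_neg ht.le]
    field_simp
  rw [smul_smul, smul_smul, hcoef, hcoef] at h
  have hin := real_inner_le_norm (v + (a * t ^ (-β)) • u + (b * t ^ (-γ)) • u) u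
  rw [hu, mul_one] at hin
  replace hin := hin.trans h
  rw [inner_add_left, inner_add_left, real_inner_smul_left, real_inner_smul_left,
    real_inner_self_eq_norm_sq, hu] at hin
  linarith

/-- Inequality (A.2) in the proof of Lemma A.2: under Assumption (G1), there exist
positive constants `c̃_G`, `C̃_G` such that `G(q) + C̃_G(|q|+1) ≥ −c̃_G log|q|`
for all `q ≠ 0`. -/
theorem stmt_3 (d : ℕ) (hd : 1 ≤ d)
    (G : EuclideanSpace ℝ (Fin d) → ℝ)
    (a₁ β₁ β₂ a₄ a₅ a₆ : ℝ)
    (ha₁ : 0 < a₁) (hβ₁ : 1 ≤ β₁) (hβ₂0 : 0 ≤ β₂) (hβ₂1 : β₂ < β₁)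
    (ha₄ : 0 < a₄) (ha₆ : 0 < a₆)
    (hGsmooth : ContDiffOn ℝ (⊤ : ℕ∞) G {(0 : EuclideanSpace ℝ (Fin d))}ᶜ)
    (hGblow : Filter.Tendsto G (nhdsWithin 0 {(0 : EuclideanSpace ℝ (Fin d))}ᶜ) Filter.atTop)
    (hGeven : ∀ q, G (-q) = G q)
    (hGodd : ∀ q : EuclideanSpace ℝ (Fin d), q ≠ 0 → gradient G (-q) = -gradient G q)
    (hGbd : ∀ q : EuclideanSpace ℝ (Fin d), q ≠ 0 →
      |G q| ≤ a₁ * (1 + ‖q‖ + ‖q‖ ^ (-β₁)))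
    (hGgradbd : ∀ q : EuclideanSpace ℝ (Fin d), q ≠ 0 →
      ‖gradient G q‖ ≤ a₁ * (1 + ‖q‖ ^ (-β₁)))
    (hGstruct : ∀ q : EuclideanSpace ℝ (Fin d), q ≠ 0 →
      ‖gradient G q + (a₄ / ‖q‖ ^ (β₁ + 1)) • q + (a₅ / ‖q‖ ^ (β₂ + 1)) • q‖ ≤ a₆) :
    ∃ cG CG : ℝ, 0 < cG ∧ 0 < CG ∧
      ∀ q : EuclideanSpace ℝ (Fin d), q ≠ 0 →
        -cG * Real.log ‖q‖ ≤ G q + CG * (‖q‖ + 1) := by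
  obtain ⟨K, hK0, hK⟩ := exists_mul_rpow_neg_le_add (abs_nonneg a₅) (half_pos ha₄) hβ₂0 hβ₂1
  refine ⟨a₄ / 2, 3 * a₁ + (a₆ + K), by positivity, by positivity, fun q hq => ?_⟩
  have hq0 : 0 < ‖q‖ := norm_pos_iff.mpr hq
  have hbd := (abs_le.mp (hGbd q hq)).1
  rcases le_total 1 ‖q‖ with hr | hr
  · have hlog := Real.log_nonneg hr
    have hpow : ‖q‖ ^ (-β₁) ≤ 1 := Real.rpow_le_one_of_one_le_of_nonpos hr (by linarith)
    nlinarith [mul_nonneg ha₄.le hlog, mul_nonneg (add_nonneg ha₆.le hK0) hq0.le,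
      mul_nonneg ha₁.le hq0.le, mul_le_mul_of_nonneg_left hpow ha₁.le]
  set u := ‖q‖⁻¹ • q with hu_def
  have hu : ‖u‖ = 1 := norm_smul_inv_norm hq
  have hu0 : u ≠ 0 := by rw [← norm_pos_iff, hu]; exact one_pos
  have hqu : ‖q‖ • u = q := smul_inv_smul₀ hq0.ne' q
  have hderiv : ∀ t : ℝ, 0 < t →
      HasDerivAt (fun s : ℝ => G (s • u) + a₄ / 2 * Real.log s)
        (inner ℝ (gradient G (t • u)) u + a₄ / 2 * t⁻¹) t := by
    intro t ht
    have hdiff : DifferentiableAt ℝ G (t • u) :=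
      (hGsmooth.contDiffAt (isOpen_compl_singleton.mem_nhds
        (smul_ne_zero ht.ne' hu0))).differentiableAt (by simp)
    exact (hasDerivAt_comp_smul hdiff).add ((Real.hasDerivAt_log ht.ne').const_mul _)
  have hle : ∀ t : ℝ, 0 < t → t ≤ 1 →
      inner ℝ (gradient G (t • u)) u + a₄ / 2 * t⁻¹ ≤ a₆ + K := by
    intro t ht ht1
    have hrad := inner_gradient_le_of_norm_le ht hu (hGstruct _ (smul_ne_zero ht.ne' hu0))
    have hinv : t⁻¹ ≤ t ^ (-β₁) := by
      rw [← Real.rpow_neg_one]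
      exact Real.rpow_le_rpow_of_exponent_ge ht ht1 (by linarith)
    have habs : -a₅ * t ^ (-β₂) ≤ |a₅| * t ^ (-β₂) := by
      gcongr
      exact neg_le_abs a₅
    have := mul_le_mul_of_nonneg_left hinv (half_pos ha₄).le
    linarith [hK t ht]
  have hmvt := (convex_Icc ‖q‖ 1).image_sub_le_mul_sub_of_deriv_le
    (f := fun s : ℝ => G (s • u) + a₄ / 2 * Real.log s) (C := a₆ + K)
    (fun t ht => (hderiv t (hq0.trans_le ht.1)).continuousAt.continuousWithinAt)
    (fun t ht => (hderiv t
      (hq0.trans_le (interior_subset ht).1)).differentiableAt.differentiableWithinAt)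
    (fun t ht => by
      have ht' := interior_subset ht
      have ht0 := hq0.trans_le ht'.1
      rw [(hderiv t ht0).deriv]
      exact hle t ht0 ht'.2)
    ‖q‖ (Set.left_mem_Icc.mpr hr) 1 (Set.right_mem_Icc.mpr hr) hr
  simp only [hqu, one_smul, Real.log_one, mul_zero, add_zero] at hmvt
  have hunit := (abs_le.mp (hGbd u hu0)).1
  rw [hu, Real.one_rpow] at hunit
  nlinarith [mul_nonneg (add_nonneg ha₆.le hK0) hq0.le, mul_nonneg ha₁.le hq0.le]
end

section
/- Let d ≥ 1, N ≥ 2, and assume Assumptions (U) and (G1) together with the normalization ∑_{i=1}^N U(qᵢ) + ∑_{1≤i<j≤N} G(qᵢ−qⱼ) ≥ 1 for all q ∈ D. Then there exist constants c > 0 and R₀ > 0 such that for all R ≥ R₀ and all q = (q₁,…,q_N) ∈ D satisfying ∑_{i=1}^N |qᵢ| + ∑_{1≤i<j≤N} |qᵢ−qⱼ|^{−1} ≥ R, one has ∑_{i=1}^N U(qᵢ) + ∑_{1≤i<j≤N} G(qᵢ−qⱼ) ≥ c · log R. (Consequence of Lemma A.2 used in the proof of Theorem 2.4, part 1) -/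
open scoped RealInnerProductSpace

lemma log_one_add_sum_le {ι : Type*} (s : Finset ι) (f : ι → ℝ) (hf : ∀ i ∈ s, 0 ≤ f i) :
    Real.log (1 + ∑ i ∈ s, f i) ≤ ∑ i ∈ s, Real.log (1 + f i) := by
  classical
  induction s using Finset.induction_on with
  | empty => simp
  | insert a s ha ih =>
    rw [Finset.sum_insert ha, Finset.sum_insert ha]
    have h0 := hf a (Finset.mem_insert_self a s)
    have hs : ∀ i ∈ s, 0 ≤ f i := fun i hi => hf i (Finset.mem_insert_of_mem hi)
    have h1 := Finset.sum_nonneg hs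
    calc Real.log (1 + (f a + ∑ i ∈ s, f i))
        ≤ Real.log ((1 + f a) * (1 + ∑ i ∈ s, f i)) :=
          Real.log_le_log (by positivity) (by nlinarith [mul_nonneg h0 h1])
      _ = Real.log (1 + f a) + Real.log (1 + ∑ i ∈ s, f i) :=
          Real.log_mul (by positivity) (by positivity)
      _ ≤ _ := by linarith [ih hs]

lemma exists_rpow_perturbation_le {β₁ β₂ a₄ : ℝ} (a₅ a₆ : ℝ) (hβ₁ : 1 ≤ β₁) (hβ : β₂ < β₁)
    (ha₄ : 0 < a₄) :
    ∃ ε : ℝ, 0 < ε ∧ ∀ t : ℝ, 0 < t → t < ε →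
      -(a₄ * t ^ (-β₁)) + |a₅| * t ^ (-β₂) + a₆ ≤ -(a₄ / 2 / t) := by
  have hlim : Filter.Tendsto (fun t : ℝ => |a₅| * t ^ (β₁ - β₂) + a₆ * t ^ β₁)
      (nhds 0) (nhds 0) := by
    have h1 := (Real.continuousAt_rpow_const 0 (β₁ - β₂) (Or.inr (by linarith))).tendsto
    have h2 := (Real.continuousAt_rpow_const 0 β₁ (Or.inr (by linarith))).tendsto
    rw [Real.zero_rpow (by linarith)] at h1 h2
    simpa using (h1.const_mul |a₅|).add (h2.const_mul a₆)
  obtain ⟨δ, hδ, hball⟩ := Metric.eventually_nhds_iff.1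
    (hlim.eventually (gt_mem_nhds (show (0 : ℝ) < a₄ / 2 by positivity)))
  refine ⟨min δ 1, by positivity, fun t ht htε => ?_⟩
  have ht1 : t ≤ 1 := (htε.trans_le (min_le_right _ _)).le
  have hsmall := @hball t (by
    rw [Real.dist_eq, sub_zero, abs_of_pos ht]
    exact htε.trans_le (min_le_left _ _))
  have hp : 0 < t ^ (-β₁) := Real.rpow_pos_of_pos ht _
  have e1 : t ^ (β₁ - β₂) * t ^ (-β₁) = t ^ (-β₂) := by
    rw [← Real.rpow_add ht]; ring_nf
  have e2 : t ^ β₁ * t ^ (-β₁) = 1 := by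
    rw [← Real.rpow_add ht]; simp
  have hinv : t⁻¹ ≤ t ^ (-β₁) := by
    rw [← Real.rpow_neg_one]
    exact Real.rpow_le_rpow_of_exponent_ge ht ht1 (by linarith)
  have h3 := mul_le_mul_of_nonneg_right hsmall.le hp.le
  have h4 := mul_le_mul_of_nonneg_left hinv (show (0 : ℝ) ≤ a₄ / 2 by positivity)
  have h5 : (|a₅| * t ^ (β₁ - β₂) + a₆ * t ^ β₁) * t ^ (-β₁) =
      |a₅| * t ^ (-β₂) + a₆ := by
    rw [add_mul, mul_assoc, mul_assoc, e1, e2, mul_one]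
  rw [h5] at h3
  rw [div_eq_mul_inv (a₄ / 2) t]
  linarith

lemma inner_le_of_norm_add_le {E : Type*} [NormedAddCommGroup E] [InnerProductSpace ℝ E]
    {β₁ β₂ a₄ a₅ a₆ t : ℝ} {u g : E} (hu : ‖u‖ = 1) (ht : 0 < t)
    (h : ‖g + (a₄ / t ^ (β₁ + 1)) • (t • u) + (a₅ / t ^ (β₂ + 1)) • (t • u)‖ ≤ a₆) :
    ⟪g, u⟫ ≤ -(a₄ * t ^ (-β₁)) + |a₅| * t ^ (-β₂) + a₆ := by
  have hc : ∀ a β : ℝ, (a / t ^ (β + 1)) * t = a * t ^ (-β) := by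
    intro a β
    rw [Real.rpow_add ht, Real.rpow_neg ht.le, Real.rpow_one]
    have := (Real.rpow_pos_of_pos ht β).ne'
    field_simp
  have h1 := real_inner_le_norm
    (g + (a₄ / t ^ (β₁ + 1)) • (t • u) + (a₅ / t ^ (β₂ + 1)) • (t • u)) u
  rw [hu, mul_one] at h1
  replace h1 := h1.trans h
  rw [smul_smul, smul_smul, hc, hc, inner_add_left, inner_add_left, real_inner_smul_left,
    real_inner_smul_left, real_inner_self_eq_norm_sq, hu] at h1
  have h2 := mul_le_mul_of_nonneg_right (neg_abs_le a₅) (Real.rpow_pos_of_pos ht (-β₂)).le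
  linarith

lemma antitoneOn_add_log_of_inner_gradient_le {E : Type*} [NormedAddCommGroup E]
    [InnerProductSpace ℝ E] [CompleteSpace E] {G : E → ℝ} {u : E} {κ ε : ℝ} (hu : u ≠ 0)
    (hG : ∀ q, q ≠ 0 → DifferentiableAt ℝ G q)
    (h : ∀ t : ℝ, 0 < t → t < ε → ⟪gradient G (t • u), u⟫ ≤ -(κ / t)) :
    AntitoneOn (fun t : ℝ => G (t • u) + κ * Real.log t) (Set.Ioc 0 ε) := by
  have hd : ∀ t : ℝ, 0 < t → HasDerivAt (fun t : ℝ => G (t • u) + κ * Real.log t)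
      (⟪gradient G (t • u), u⟫ + κ * t⁻¹) t := by
    intro t ht
    have h1 := (hG (t • u) (smul_ne_zero ht.ne' hu)).hasGradientAt.hasFDerivAt
    have h2 : HasDerivAt (fun t : ℝ => t • u) u t := by
      simpa using (hasDerivAt_id t).smul_const u
    have h3 := h1.comp_hasDerivAt t h2
    rw [InnerProductSpace.toDual_apply_apply] at h3
    exact h3.add ((Real.hasDerivAt_log ht.ne').const_mul κ)
  refine antitoneOn_of_deriv_nonpos (convex_Ioc 0 ε)
    (fun t ht => (hd t ht.1).continuousAt.continuousWithinAt) ?_ ?_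
  · intro t ht
    rw [interior_Ioc] at ht
    exact (hd t ht.1).differentiableAt.differentiableWithinAt
  · intro t ht
    rw [interior_Ioc] at ht
    rw [(hd t ht.1).deriv, ← div_eq_mul_inv]
    linarith [h t ht.1 ht.2]

lemma exists_log_lower_bound {E : Type*} [NormedAddCommGroup E]
    [InnerProductSpace ℝ E] [CompleteSpace E] {G : E → ℝ} {a₁ β₁ β₂ a₄ a₅ a₆ : ℝ}
    (ha₁ : 0 < a₁) (hβ₁ : 1 ≤ β₁) (hβ : β₂ < β₁) (ha₄ : 0 < a₄)
    (hG : ∀ q, q ≠ 0 → DifferentiableAt ℝ G q)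
    (hGbd : ∀ q, q ≠ 0 → |G q| ≤ a₁ * (1 + ‖q‖ + ‖q‖ ^ (-β₁)))
    (hGstruct : ∀ q, q ≠ 0 →
      ‖gradient G q + (a₄ / ‖q‖ ^ (β₁ + 1)) • q + (a₅ / ‖q‖ ^ (β₂ + 1)) • q‖ ≤ a₆) :
    ∃ κ C : ℝ, 0 < κ ∧ 0 < C ∧
      ∀ q, q ≠ 0 → κ * Real.log (1 + ‖q‖⁻¹) - C * (1 + ‖q‖) ≤ G q := by
  obtain ⟨ε, hε, hbound⟩ := exists_rpow_perturbation_le a₅ a₆ hβ₁ hβ ha₄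
  have hp : 0 < ε ^ (-β₁) := Real.rpow_pos_of_pos hε _
  set κ := a₄ / 2 with hκdef
  have hκ : 0 < κ := by positivity
  set B := a₁ * (1 + ε + ε ^ (-β₁)) with hB
  have hBpos : 0 < B := by positivity
  refine ⟨κ, κ + a₁ + B + κ * |Real.log ε|, hκ, by positivity, fun q hq => ?_⟩
  have hr : 0 < ‖q‖ := norm_pos_iff.2 hq
  have key : -(κ * Real.log ‖q‖) - B - κ * |Real.log ε| - a₁ * ‖q‖ ≤ G q := by
    rcases le_total ‖q‖ ε with hle | hle
    · set u := ‖q‖⁻¹ • q with hudef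
      have hu : ‖u‖ = 1 := by
        rw [hudef, norm_smul, norm_inv, norm_norm, inv_mul_cancel₀ hr.ne']
      have hu0 : u ≠ 0 := by
        intro h; rw [h, norm_zero] at hu; exact zero_ne_one hu
      have hnorm : ∀ t : ℝ, 0 < t → ‖t • u‖ = t := by
        intro t ht
        rw [norm_smul, hu, mul_one, Real.norm_of_nonneg ht.le]
      have hanti := antitoneOn_add_log_of_inner_gradient_le (κ := κ) (ε := ε) hu0 hG
        (fun t ht htε => by
          have hs := hGstruct (t • u) (smul_ne_zero ht.ne' hu0)
          rw [hnorm t ht] at hs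
          exact (inner_le_of_norm_add_le hu ht hs).trans (hbound t ht htε))
      have h1 := hanti ⟨hr, hle⟩ ⟨hε, le_rfl⟩ hle
      have hqu : ‖q‖ • u = q := by
        rw [hudef, smul_smul, mul_inv_cancel₀ hr.ne', one_smul]
      simp only [hqu] at h1
      have h2 := hGbd (ε • u) (smul_ne_zero hε.ne' hu0)
      rw [hnorm ε hε] at h2
      have h3 := (abs_le.1 h2).1
      have h4 := mul_le_mul_of_nonneg_left (neg_abs_le (Real.log ε)) hκ.le
      have h5 : 0 < a₁ * ‖q‖ := by positivity
      linarith
    · have h1 := (abs_le.1 (hGbd q hq)).1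
      have h2 : ‖q‖ ^ (-β₁) ≤ ε ^ (-β₁) :=
        Real.rpow_le_rpow_of_nonpos hε hle (by linarith)
      have h3 := mul_le_mul_of_nonneg_left
        ((neg_abs_le (Real.log ε)).trans (Real.log_le_log hε hle)) hκ.le
      have h4 := mul_le_mul_of_nonneg_left h2 ha₁.le
      have h5 : 0 < a₁ * ε := by positivity
      rw [hB]
      linarith
  have hlog : Real.log (1 + ‖q‖⁻¹) ≤ ‖q‖ - Real.log ‖q‖ := by
    have h1 : 1 + ‖q‖⁻¹ = (1 + ‖q‖) / ‖q‖ := by field_simp; ring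
    rw [h1, Real.log_div (by positivity) hr.ne']
    linarith [Real.log_le_sub_one_of_pos (show 0 < 1 + ‖q‖ by positivity)]
  have h1 := mul_le_mul_of_nonneg_left hlog hκ.le
  have h2 : 0 ≤ (B + κ * |Real.log ε|) * ‖q‖ := by positivity
  linarith

lemma linear_le_of_rpow_sub_le {a lam r x : ℝ} (M : ℝ) (ha : 0 < a) (hlam : 1 ≤ lam)
    (hr : 0 ≤ r) (h : (1 / a) * r ^ (lam + 1) - a ≤ x) :
    M * r - (a * M ^ 2 + 1 / a + a) ≤ x := by
  have h1 : r ^ 2 - 1 ≤ r ^ (lam + 1) := by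
    rcases le_total r 1 with hr1 | hr1
    · have := Real.rpow_nonneg hr (lam + 1)
      nlinarith
    · have := Real.rpow_le_rpow_of_exponent_le hr1 (show (2 : ℝ) ≤ lam + 1 by linarith)
      rw [Real.rpow_two] at this
      linarith
  have h2 := mul_le_mul_of_nonneg_left h1 (show (0 : ℝ) ≤ 1 / a by positivity)
  have h3 : 0 ≤ 1 / a * r ^ 2 - M * r + a * M ^ 2 := by
    have : 1 / a * r ^ 2 - M * r + a * M ^ 2 =
        1 / a * ((r - a * M / 2) ^ 2 + 3 / 4 * (a * M) ^ 2) := by field_simp; ring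
    rw [this]; positivity
  linarith

/-- Consequence of Lemma A.2 used in the proof of Theorem 2.4, part 1: under
Assumptions (U) and (G1) and the normalization, there exist `c > 0` and `R₀ > 0` such
that for all `R ≥ R₀` and all `q ∈ D` with `∑|qᵢ| + ∑_{i<j}|qᵢ−qⱼ|⁻¹ ≥ R`, one has
`∑ U(qᵢ) + ∑_{i<j} G(qᵢ−qⱼ) ≥ c log R`. -/
theorem stmt_4 (d N : ℕ) (hd : 1 ≤ d) (hN : 2 ≤ N)
    (U G : EuclideanSpace ℝ (Fin d) → ℝ)
    (a₁ lam a₂ a₃ β₁ β₂ a₄ a₅ a₆ : ℝ)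
    (ha₁ : 0 < a₁) (hlam : 1 ≤ lam) (ha₂ : 0 < a₂) (ha₃ : 0 < a₃)
    (hβ₁ : 1 ≤ β₁) (hβ₂0 : 0 ≤ β₂) (hβ₂1 : β₂ < β₁) (ha₄ : 0 < a₄) (ha₆ : 0 < a₆)
    (hUsmooth : ContDiff ℝ (⊤ : ℕ∞) U)
    (hUone : ∀ q, 1 ≤ U q)
    (hUlow : ∀ q : EuclideanSpace ℝ (Fin d), (1 / a₁) * ‖q‖ ^ (lam + 1) - a₁ ≤ U q)
    (hUup : ∀ q : EuclideanSpace ℝ (Fin d), U q ≤ a₁ * (1 + ‖q‖ ^ (lam + 1)))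
    (hUgrad : ∀ q : EuclideanSpace ℝ (Fin d), ‖gradient U q‖ ≤ a₁ * (1 + ‖q‖ ^ lam))
    (hUcoer : ∀ q : EuclideanSpace ℝ (Fin d), a₂ * ‖q‖ ^ (lam + 1) - a₃ ≤ ⟪gradient U q, q⟫)
    (hGsmooth : ContDiffOn ℝ (⊤ : ℕ∞) G {(0 : EuclideanSpace ℝ (Fin d))}ᶜ)
    (hGblow : Filter.Tendsto G (nhdsWithin 0 {(0 : EuclideanSpace ℝ (Fin d))}ᶜ) Filter.atTop)
    (hGeven : ∀ q, G (-q) = G q)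
    (hGodd : ∀ q : EuclideanSpace ℝ (Fin d), q ≠ 0 → gradient G (-q) = -gradient G q)
    (hGbd : ∀ q : EuclideanSpace ℝ (Fin d), q ≠ 0 →
      |G q| ≤ a₁ * (1 + ‖q‖ + ‖q‖ ^ (-β₁)))
    (hGgradbd : ∀ q : EuclideanSpace ℝ (Fin d), q ≠ 0 →
      ‖gradient G q‖ ≤ a₁ * (1 + ‖q‖ ^ (-β₁)))
    (hGstruct : ∀ q : EuclideanSpace ℝ (Fin d), q ≠ 0 →
      ‖gradient G q + (a₄ / ‖q‖ ^ (β₁ + 1)) • q + (a₅ / ‖q‖ ^ (β₂ + 1)) • q‖ ≤ a₆)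
    (hNorm : ∀ q : Fin N → EuclideanSpace ℝ (Fin d), Function.Injective q →
      1 ≤ ∑ i, U (q i) +
          ∑ i : Fin N, ∑ j ∈ Finset.univ.filter (fun j => i < j), G (q i - q j)) :
    ∃ c R₀ : ℝ, 0 < c ∧ 0 < R₀ ∧
      ∀ R : ℝ, R₀ ≤ R →
        ∀ q : Fin N → EuclideanSpace ℝ (Fin d), Function.Injective q →
          R ≤ ∑ i, ‖q i‖ +
              ∑ i : Fin N, ∑ j ∈ Finset.univ.filter (fun j => i < j), ‖q i - q j‖⁻¹ →
          c * Real.log R ≤ ∑ i, U (q i) +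
              ∑ i : Fin N, ∑ j ∈ Finset.univ.filter (fun j => i < j), G (q i - q j) := by
  have hGdiff : ∀ q, q ≠ 0 → DifferentiableAt ℝ G q := fun q hq =>
    (hGsmooth.contDiffAt (isOpen_compl_singleton.mem_nhds hq)).differentiableAt (by simp)
  obtain ⟨κ, C, hκ, hC, hGlow⟩ :=
    exists_log_lower_bound ha₁ hβ₁ hβ₂1 ha₄ hGdiff hGbd hGstruct
  set M : ℝ := 2 * C * N ^ 2 + κ with hM
  set K : ℝ := N * (a₁ * M ^ 2 + 1 / a₁ + a₁) + C * N ^ 2 with hK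
  refine ⟨κ / 2, Real.exp (2 * K / κ), by positivity, Real.exp_pos _, ?_⟩
  intro R hR q hq hsum
  set S := ∑ i, ‖q i‖ with hS
  set T := ∑ i : Fin N, ∑ j ∈ Finset.univ.filter (fun j => i < j), ‖q i - q j‖⁻¹ with hT
  have hS0 : 0 ≤ S := Finset.sum_nonneg fun i _ => norm_nonneg _
  have hT0 : 0 ≤ T := by positivity
  have hRpos : 0 < R := (Real.exp_pos _).trans_le hR
  have hUsum : M * S - N * (a₁ * M ^ 2 + 1 / a₁ + a₁) ≤ ∑ i, U (q i) := by
    calc M * S - N * (a₁ * M ^ 2 + 1 / a₁ + a₁)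
        = ∑ i, (M * ‖q i‖ - (a₁ * M ^ 2 + 1 / a₁ + a₁)) := by
          rw [Finset.sum_sub_distrib, ← Finset.mul_sum]; simp [hS, mul_add]
      _ ≤ _ := Finset.sum_le_sum fun i _ =>
          linear_le_of_rpow_sub_le M ha₁ hlam (norm_nonneg _) (hUlow _)
  have hpair : ∀ i j : Fin N, ‖q i - q j‖ ≤ 2 * S := fun i j => by
    have h : ∀ i, ‖q i‖ ≤ S := fun i =>
      Finset.single_le_sum (f := fun i => ‖q i‖) (fun i _ => norm_nonneg _) (Finset.mem_univ i)
    linarith [norm_sub_le (q i) (q j), h i, h j]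
  have hlogT : Real.log (1 + T) ≤ ∑ i : Fin N, ∑ j ∈ Finset.univ.filter (fun j => i < j),
      Real.log (1 + ‖q i - q j‖⁻¹) :=
    (log_one_add_sum_le _ _ fun i _ => by positivity).trans
      (Finset.sum_le_sum fun i _ => log_one_add_sum_le _ _ fun j _ => by positivity)
  have hcount : ∑ i : Fin N, ∑ j ∈ Finset.univ.filter (fun j => i < j), C * (1 + 2 * S) ≤
      N ^ 2 * (C * (1 + 2 * S)) := by
    calc _ ≤ ∑ i : Fin N, ∑ j : Fin N, C * (1 + 2 * S) :=
          Finset.sum_le_sum fun i _ => Finset.sum_le_sum_of_subset_of_nonneg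
            (Finset.filter_subset _ _) fun _ _ _ => by positivity
      _ = _ := by
          simp only [Finset.sum_const, Finset.card_univ, Fintype.card_fin, nsmul_eq_mul]; ring
  have hGsum : κ * Real.log (1 + T) - N ^ 2 * (C * (1 + 2 * S)) ≤
      ∑ i : Fin N, ∑ j ∈ Finset.univ.filter (fun j => i < j), G (q i - q j) := by
    calc κ * Real.log (1 + T) - N ^ 2 * (C * (1 + 2 * S))
        ≤ κ * (∑ i : Fin N, ∑ j ∈ Finset.univ.filter (fun j => i < j),
            Real.log (1 + ‖q i - q j‖⁻¹)) -
          ∑ i : Fin N, ∑ j ∈ Finset.univ.filter (fun j => i < j), C * (1 + 2 * S) :=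
          sub_le_sub (mul_le_mul_of_nonneg_left hlogT hκ.le) hcount
      _ = ∑ i : Fin N, ∑ j ∈ Finset.univ.filter (fun j => i < j),
            (κ * Real.log (1 + ‖q i - q j‖⁻¹) - C * (1 + 2 * S)) := by
          simp only [Finset.mul_sum, Finset.sum_sub_distrib]
      _ ≤ _ := by
          refine Finset.sum_le_sum fun i _ => Finset.sum_le_sum fun j hj => ?_
          have hij : q i - q j ≠ 0 :=
            sub_ne_zero.2 fun h => (Finset.mem_filter.1 hj).2.ne (hq h)
          have h1 := hGlow _ hij
          have h2 := mul_le_mul_of_nonneg_left (hpair i j) hC.le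
          linarith
  have hlogR : Real.log R ≤ S + Real.log (1 + T) := by
    calc Real.log R ≤ Real.log ((1 + S) * (1 + T)) :=
          Real.log_le_log hRpos (by nlinarith [mul_nonneg hS0 hT0])
      _ = Real.log (1 + S) + Real.log (1 + T) :=
          Real.log_mul (by positivity) (by positivity)
      _ ≤ _ := by
          linarith [Real.log_le_sub_one_of_pos (show 0 < 1 + S by positivity)]
  have hlogR0 : 2 * K / κ ≤ Real.log R := (Real.le_log_iff_exp_le hRpos).2 hR
  rw [div_le_iff₀ hκ] at hlogR0
  have h1 := mul_le_mul_of_nonneg_left hlogR hκ.le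
  have h2 : M * S = 2 * C * N ^ 2 * S + κ * S := by rw [hM]; ring
  linarith
end

section
/- Let d ≥ 1 and assume Assumptions (U) and (G1). For every ε ∈ (0,1) there exists a constant C > 0 (depending on ε but not on q, p) such that for all (q,p) ∈ (ℝ^d ∖ {0}) × ℝ^d: L₁(−⟨q,p⟩/|q|)(q,p) ≤ a₁|q|^λ − (a₄/2)·|q|^{−β₁} + C. (Inequality (3.13) in the proof of Lemma 3.1) -/
open scoped RealInnerProductSpace

/-- The single-particle generator `L₁` of the relativistic Langevin dynamics:
`L₁φ = ⟨p/√(1+ε|p|²), ∇_q φ⟩ + ⟨−p/√(1+ε|p|²) − ∇U(q) − ∇G(q), ∇_p φ⟩ + Δ_p φ`. -/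
noncomputable def L1 {d : ℕ} (ε : ℝ) (U G : EuclideanSpace ℝ (Fin d) → ℝ)
    (φ : EuclideanSpace ℝ (Fin d) → EuclideanSpace ℝ (Fin d) → ℝ)
    (q p : EuclideanSpace ℝ (Fin d)) : ℝ :=
  ⟪(Real.sqrt (1 + ε * ‖p‖ ^ 2))⁻¹ • p, gradient (fun q' => φ q' p) q⟫
    + ⟪-((Real.sqrt (1 + ε * ‖p‖ ^ 2))⁻¹ • p) - gradient U q - gradient G q,
        gradient (fun p' => φ q p') p⟫
    + ∑ i : Fin d,
        fderiv ℝ (fun p' => fderiv ℝ (fun p'' => φ q p'') p' (EuclideanSpace.single i 1))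
          p (EuclideanSpace.single i 1)

/-- The single-particle Hamiltonian `H(q,p) = εU(q) + εG(q) + √(1+ε|p|²)`. -/
noncomputable def H1 {d : ℕ} (ε : ℝ) (U G : EuclideanSpace ℝ (Fin d) → ℝ)
    (q p : EuclideanSpace ℝ (Fin d)) : ℝ :=
  ε * U q + ε * G q + Real.sqrt (1 + ε * ‖p‖ ^ 2)


section

variable {E : Type*} [NormedAddCommGroup E] [InnerProductSpace ℝ E]

theorem gradient_apply_inner [CompleteSpace E] (f : E → ℝ) (q v : E) :
    ⟪v, gradient f q⟫ = fderiv ℝ f q v := by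
  rw [real_inner_comm, gradient, InnerProductSpace.toDual_symm_apply]

/-- The radial momentum `⟪q, p⟫ / ‖q‖` has nonnegative derivative in `q` in the direction `p`. -/
theorem fderiv_neg_inner_div_norm_nonpos {q : E} (hq : q ≠ 0) (p : E) :
    fderiv ℝ (fun q' => -(⟪q', p⟫ / ‖q'‖)) q p ≤ 0 := by
  have hn : 0 < ‖q‖ := norm_pos_iff.mpr hq
  have hN := ((contDiffAt_norm ℝ hq (n := 1)).differentiableAt one_ne_zero)
  have hNp : fderiv ℝ (fun x : E => ‖x‖) q p = ⟪q, p⟫ / ‖q‖ := by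
    have h1 := hN.hasFDerivAt.mul hN.hasFDerivAt
    have h2 := (hasStrictFDerivAt_norm_sq q).hasFDerivAt
    have h3 : HasFDerivAt (fun x : E => ‖x‖ ^ 2) _ q :=
      h1.congr_of_eventuallyEq (.of_forall fun x => by simp [pow_two])
    have h4 := congrArg (fun L : E →L[ℝ] ℝ => L p) (h3.unique h2)
    simp at h4
    rw [eq_div_iff hn.ne']
    linarith
  have hI : HasFDerivAt (fun x : E => ⟪x, p⟫) (innerSL ℝ p) q :=
    (innerSL ℝ p).hasFDerivAt.congr_of_eventuallyEq
      (.of_forall fun x => by simp [real_inner_comm])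
  have hinv := (hasDerivAt_inv hn.ne').comp_hasFDerivAt q hN.hasFDerivAt
  have h : HasFDerivAt (fun q' => -(⟪q', p⟫ / ‖q'‖)) _ q :=
    (hI.mul hinv).neg.congr_of_eventuallyEq (.of_forall fun x => by simp [div_eq_mul_inv])
  rw [h.fderiv]
  simp only [neg_apply, smul_apply,
    add_apply, hNp, innerSL_apply_apply, smul_eq_mul,
    real_inner_self_eq_norm_sq, Function.comp_apply]
  have hcs : ⟪q, p⟫ ^ 2 ≤ (‖q‖ * ‖p‖) ^ 2 :=
    sq_le_sq' (neg_le_of_abs_le (abs_real_inner_le_norm q p)) (real_inner_le_norm q p)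
  rw [neg_nonpos]
  have h_eq : ⟪q, p⟫ * (-(‖q‖ ^ 2)⁻¹ * (⟪q, p⟫ / ‖q‖)) + ‖q‖⁻¹ * ‖p‖ ^ 2
      = ((‖q‖ * ‖p‖) ^ 2 - ⟪q, p⟫ ^ 2) / ‖q‖ ^ 3 := by
    field_simp
    ring
  rw [h_eq]
  exact div_nonneg (sub_nonneg.mpr hcs) (by positivity)

theorem hasFDerivAt_neg_inner_div_norm (q p : E) :
    HasFDerivAt (fun p' => -(⟪q, p'⟫ / ‖q‖)) (-(‖q‖⁻¹ • innerSL ℝ q)) p :=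
  (-(‖q‖⁻¹ • innerSL ℝ q)).hasFDerivAt.congr_of_eventuallyEq
    (.of_forall fun x => by simp [div_eq_inv_mul])

theorem inner_inv_sqrt_smul_le {ε : ℝ} (hε : 0 < ε) (q p : E) :
    ⟪(Real.sqrt (1 + ε * ‖p‖ ^ 2))⁻¹ • p, q⟫ ≤ (Real.sqrt ε)⁻¹ * ‖q‖ := by
  refine (real_inner_le_norm _ _).trans (mul_le_mul_of_nonneg_right ?_ (norm_nonneg _))
  have hs : 0 < Real.sqrt (1 + ε * ‖p‖ ^ 2) := by positivity
  have he : 0 < Real.sqrt ε := by positivity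
  rw [norm_smul, Real.norm_of_nonneg (by positivity), inv_mul_le_iff₀ hs, ← div_eq_mul_inv,
    le_div_iff₀ he]
  refine Real.le_sqrt_of_sq_le ?_
  rw [mul_pow, Real.sq_sqrt hε.le]
  linarith

end

/-- A lower power is dominated by any positive multiple of a higher power, up to a constant. -/
theorem exists_mul_rpow_le_mul_rpow_add {a b α β : ℝ} (ha : 0 < a) (hα : 0 ≤ α) (hαβ : α < β) :
    ∃ C : ℝ, 0 ≤ C ∧ ∀ y : ℝ, 0 < y → |b| * y ^ α ≤ a * y ^ β + C := by
  obtain ⟨M, hM⟩ := Filter.eventually_atTop.mp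
    ((tendsto_rpow_atTop (sub_pos.mpr hαβ)).eventually_ge_atTop (|b| / a))
  refine ⟨|b| * |M| ^ α, by positivity, fun y hy => ?_⟩
  rcases le_total M y with h | h
  · have h1 := (div_le_iff₀ ha).mp (hM y h)
    have h2 : y ^ β = y ^ (β - α) * y ^ α := by rw [← Real.rpow_add hy, sub_add_cancel]
    have h3 := mul_le_mul_of_nonneg_right h1 (Real.rpow_nonneg hy.le α)
    have h4 : 0 ≤ |b| * |M| ^ α := by positivity
    rw [h2]
    linarith
  · have h1 : y ^ α ≤ |M| ^ α := Real.rpow_le_rpow hy.le (h.trans (le_abs_self M)) hα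
    have h2 := mul_le_mul_of_nonneg_left h1 (abs_nonneg b)
    have h3 : 0 ≤ a * y ^ β := by positivity
    linarith

/-- Inequality (3.13) in the proof of Lemma 3.1: under Assumptions (U) and (G1), for
every `ε ∈ (0,1)` there exists `C > 0` such that for all `q ≠ 0` and `p`,
`L₁(−⟨q,p⟩/|q|)(q,p) ≤ a₁|q|^λ − (a₄/2)|q|^{−β₁} + C`. -/
theorem stmt_10 (d : ℕ) (hd : 1 ≤ d) (ε : ℝ) (hε : ε ∈ Set.Ioo (0 : ℝ) 1)
    (U G : EuclideanSpace ℝ (Fin d) → ℝ)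
    (a₁ lam a₂ a₃ β₁ β₂ a₄ a₅ a₆ : ℝ)
    (ha₁ : 0 < a₁) (hlam : 1 ≤ lam) (ha₂ : 0 < a₂) (ha₃ : 0 < a₃)
    (hβ₁ : 1 ≤ β₁) (hβ₂0 : 0 ≤ β₂) (hβ₂1 : β₂ < β₁) (ha₄ : 0 < a₄) (ha₆ : 0 < a₆)
    (hUsmooth : ContDiff ℝ (⊤ : ℕ∞) U)
    (hUone : ∀ q, 1 ≤ U q)
    (hUlow : ∀ q : EuclideanSpace ℝ (Fin d), (1 / a₁) * ‖q‖ ^ (lam + 1) - a₁ ≤ U q)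
    (hUup : ∀ q : EuclideanSpace ℝ (Fin d), U q ≤ a₁ * (1 + ‖q‖ ^ (lam + 1)))
    (hUgrad : ∀ q : EuclideanSpace ℝ (Fin d), ‖gradient U q‖ ≤ a₁ * (1 + ‖q‖ ^ lam))
    (hUcoer : ∀ q : EuclideanSpace ℝ (Fin d), a₂ * ‖q‖ ^ (lam + 1) - a₃ ≤ ⟪gradient U q, q⟫)
    (hGsmooth : ContDiffOn ℝ (⊤ : ℕ∞) G {(0 : EuclideanSpace ℝ (Fin d))}ᶜ)
    (hGblow : Filter.Tendsto G (nhdsWithin 0 {(0 : EuclideanSpace ℝ (Fin d))}ᶜ) Filter.atTop)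
    (hGeven : ∀ q, G (-q) = G q)
    (hGodd : ∀ q : EuclideanSpace ℝ (Fin d), q ≠ 0 → gradient G (-q) = -gradient G q)
    (hGbd : ∀ q : EuclideanSpace ℝ (Fin d), q ≠ 0 →
      |G q| ≤ a₁ * (1 + ‖q‖ + ‖q‖ ^ (-β₁)))
    (hGgradbd : ∀ q : EuclideanSpace ℝ (Fin d), q ≠ 0 →
      ‖gradient G q‖ ≤ a₁ * (1 + ‖q‖ ^ (-β₁)))
    (hGstruct : ∀ q : EuclideanSpace ℝ (Fin d), q ≠ 0 →
      ‖gradient G q + (a₄ / ‖q‖ ^ (β₁ + 1)) • q + (a₅ / ‖q‖ ^ (β₂ + 1)) • q‖ ≤ a₆)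
    :
    ∃ C : ℝ, 0 < C ∧
      ∀ q : EuclideanSpace ℝ (Fin d), q ≠ 0 → ∀ p : EuclideanSpace ℝ (Fin d),
        L1 ε U G (fun q' p' => -(⟪q', p'⟫ / ‖q'‖)) q p
          ≤ a₁ * ‖q‖ ^ lam - (a₄ / 2) * ‖q‖ ^ (-β₁) + C := by
  obtain ⟨hε0, -⟩ := hε
  obtain ⟨C, hC, hy⟩ := exists_mul_rpow_le_mul_rpow_add (b := a₅) (half_pos ha₄) hβ₂0 hβ₂1
  refine ⟨(Real.sqrt ε)⁻¹ + a₁ + a₆ + C, by positivity, fun q hq p => ?_⟩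
  have hn : 0 < ‖q‖ := norm_pos_iff.mpr hq
  have hlap : ∑ i : Fin d, fderiv ℝ (fun p' => fderiv ℝ (fun p'' => -(⟪q, p''⟫ / ‖q‖)) p'
      (EuclideanSpace.single i 1)) p (EuclideanSpace.single i 1) = 0 :=
    Finset.sum_eq_zero fun i _ => by
      simp only [(hasFDerivAt_neg_inner_div_norm q _).fderiv]
      simp
  have hdq : ⟪(Real.sqrt (1 + ε * ‖p‖ ^ 2))⁻¹ • p,
      gradient (fun q' => -(⟪q', p⟫ / ‖q'‖)) q⟫ ≤ 0 := by
    rw [inner_smul_left, gradient_apply_inner]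
    exact mul_nonpos_of_nonneg_of_nonpos (by simp) (fderiv_neg_inner_div_norm_nonpos hq p)
  have hkin := inner_inv_sqrt_smul_le hε0 q p
  have hU : ⟪gradient U q, q⟫ ≤ a₁ * (1 + ‖q‖ ^ lam) * ‖q‖ :=
    (real_inner_le_norm _ _).trans (mul_le_mul_of_nonneg_right (hUgrad q) hn.le)
  have hpow : ∀ a β : ℝ, a / ‖q‖ ^ (β + 1) * ‖q‖ ^ 2 = a * ‖q‖ ^ (-β) * ‖q‖ := fun a β => by
    rw [Real.rpow_add_one hn.ne', Real.rpow_neg hn.le]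
    field_simp
  have hG : ⟪gradient G q, q⟫ ≤ (a₆ - a₄ * ‖q‖ ^ (-β₁) - a₅ * ‖q‖ ^ (-β₂)) * ‖q‖ := by
    have h := (real_inner_le_norm _ q).trans
      (mul_le_mul_of_nonneg_right (hGstruct q hq) hn.le)
    rw [inner_add_left, inner_add_left, real_inner_smul_left, real_inner_smul_left,
      real_inner_self_eq_norm_sq, hpow, hpow] at h
    linarith
  have hlow : -(a₅ * ‖q‖ ^ (-β₂)) ≤ a₄ / 2 * ‖q‖ ^ (-β₁) + C := by
    have h := hy ‖q‖⁻¹ (inv_pos.mpr hn)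
    rw [Real.inv_rpow hn.le, Real.inv_rpow hn.le, ← Real.rpow_neg hn.le,
      ← Real.rpow_neg hn.le] at h
    have h2 := mul_le_mul_of_nonneg_right (neg_le_abs a₅) (Real.rpow_nonneg hn.le (-β₂))
    linarith
  have hdp : ⟪-((Real.sqrt (1 + ε * ‖p‖ ^ 2))⁻¹ • p) - gradient U q - gradient G q,
      gradient (fun p' => -(⟪q, p'⟫ / ‖q‖)) p⟫
      ≤ (Real.sqrt ε)⁻¹ + a₁ * (1 + ‖q‖ ^ lam)
        + (a₆ - a₄ * ‖q‖ ^ (-β₁) - a₅ * ‖q‖ ^ (-β₂)) := by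
    rw [gradient_apply_inner, (hasFDerivAt_neg_inner_div_norm q p).fderiv]
    simp only [neg_apply, smul_apply,
      innerSL_apply_apply, smul_eq_mul]
    rw [← mul_neg, inv_mul_le_iff₀ hn, real_inner_comm, inner_sub_left, inner_sub_left,
      inner_neg_left]
    linarith
  unfold L1
  rw [hlap]
  linarith
end

section
/- Let d ≥ 1 and assume Assumptions (U) and (G1). Then there exist ε₀ ∈ (0,1) and c > 0 (independent of ε) such that for every ε ∈ (0,ε₀) there is a constant C > 0 (possibly depending on ε) with L₁( H² + ε⟨q,p⟩ − ⟨q,p⟩/|q| )(q,p) ≤ −c·H(q,p) + C for all (q,p) ∈ (ℝ^d ∖ {0}) × ℝ^d. (Inequality (3.14) in the proof of Lemma 3.1) -/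
open scoped RealInnerProductSpace

/-- Interpolation of powers: an intermediate power is dominated by any positive multiples of a larger
and a smaller power, up to a constant. -/
theorem exists_mul_rpow_le_add_rpow {A B K a b e : ℝ} (hA : 0 < A) (hB : 0 < B) (hK : 0 ≤ K)
    (hb : b < e) (ha : e < a) :
    ∃ C : ℝ, 0 ≤ C ∧ ∀ r : ℝ, 0 < r → K * r ^ e ≤ A * r ^ a + B * r ^ b + C := by
  set R₁ := (K / A) ^ (1 / (a - e))
  set R₀ := (K / B) ^ (1 / (b - e))
  have hR₁ : 0 ≤ R₁ := Real.rpow_nonneg (by positivity) _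
  have hR₀ : 0 ≤ R₀ := Real.rpow_nonneg (by positivity) _
  refine ⟨K * (R₀ ^ e + R₁ ^ e), by positivity, fun r hr => ?_⟩
  have hC₀ : 0 ≤ K * R₀ ^ e := by positivity
  have hC₁ : 0 ≤ K * R₁ ^ e := by positivity
  have hAa : 0 < A * r ^ a := by positivity
  have hBb : 0 < B * r ^ b := by positivity
  have hre : 0 < r ^ e := by positivity
  rcases le_or_gt (K / A) (r ^ (a - e)) with h | h
  · rw [Real.rpow_sub hr, div_le_div_iff₀ hA hre] at h
    nlinarith
  rcases le_or_gt (K / B) (r ^ (b - e)) with h' | h'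
  · rw [Real.rpow_sub hr, div_le_div_iff₀ hB hre] at h'
    nlinarith
  have hKA : 0 < K / A := lt_trans (by positivity) h
  have hK0 : 0 < K := by
    rcases hK.eq_or_lt with h0 | h0
    · simp [← h0] at hKA
    · exact h0
  rcases le_or_gt 0 e with he | he
  · have : r ≤ R₁ := by
      have := Real.rpow_le_rpow (by positivity) h.le (one_div_nonneg.2 (sub_pos.2 ha).le)
      rwa [← Real.rpow_mul hr.le, mul_one_div_cancel (sub_pos.2 ha).ne', Real.rpow_one] at this
    have := mul_le_mul_of_nonneg_left (Real.rpow_le_rpow hr.le this he) hK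
    linarith
  · have : R₀ ≤ r := by
      have := Real.rpow_le_rpow_of_nonpos (by positivity) h'.le (one_div_nonpos.2 (sub_neg.2 hb).le)
      rwa [← Real.rpow_mul hr.le, mul_one_div_cancel (sub_neg.2 hb).ne, Real.rpow_one] at this
    have hpos : 0 < R₀ := Real.rpow_pos_of_pos (by positivity) _
    have := mul_le_mul_of_nonneg_left (Real.rpow_le_rpow_of_nonpos hpos this he.le) hK
    linarith

theorem one_add_mul_norm_sq_pos {F : Type*} [NormedAddCommGroup F] {ε : ℝ} (hε : 0 < ε) (p : F) :
    0 < 1 + ε * ‖p‖ ^ 2 := by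
  positivity

section Derivatives

variable {E : Type*} [NormedAddCommGroup E] [InnerProductSpace ℝ E]

theorem hasFDerivAt_sqrt_one_add_mul_norm_sq {ε : ℝ} (hε : 0 < ε) (p : E) :
    HasFDerivAt (fun p : E => √(1 + ε * ‖p‖ ^ 2))
      ((ε / √(1 + ε * ‖p‖ ^ 2)) • innerSL ℝ p) p := by
  have h := ((((hasStrictFDerivAt_norm_sq p).hasFDerivAt).const_mul ε).const_add 1).sqrt
    (one_add_mul_norm_sq_pos hε p).ne'
  refine h.congr_fderiv ?_
  ext w
  simp
  ring

theorem hasFDerivAt_inner_left (w x : E) :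
    HasFDerivAt (fun x : E => ⟪x, w⟫) (innerSL ℝ w) x := by
  refine HasFDerivAt.congr_of_eventuallyEq (innerSL ℝ w).hasFDerivAt (.of_forall fun y => ?_)
  simp [real_inner_comm]

theorem hasFDerivAt_norm_of_ne_zero {q : E} (hq : q ≠ 0) :
    HasFDerivAt (fun q : E => ‖q‖) (‖q‖⁻¹ • innerSL ℝ q) q := by
  have hn : ‖q‖ ≠ 0 := norm_ne_zero_iff.2 hq
  have h := ((hasStrictFDerivAt_norm_sq q).hasFDerivAt).sqrt (by positivity)
  simp only [Real.sqrt_sq (norm_nonneg _)] at h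
  refine h.congr_fderiv ?_
  ext w
  simp
  field_simp

theorem hasFDerivAt_inner_div_norm {q : E} (hq : q ≠ 0) (p : E) :
    HasFDerivAt (fun q : E => ⟪q, p⟫ / ‖q‖)
      (‖q‖⁻¹ • innerSL ℝ p - (⟪q, p⟫ / ‖q‖ ^ 3) • innerSL ℝ q) q := by
  have hn : ‖q‖ ≠ 0 := norm_ne_zero_iff.2 hq
  have h1 := hasFDerivAt_inner_left p q
  have h := h1.mul ((hasDerivAt_inv hn).comp_hasFDerivAt q (hasFDerivAt_norm_of_ne_zero hq))
  refine h.congr_fderiv ?_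
  ext w
  simp
  field_simp
  ring

theorem fderiv_lyapunov_position [CompleteSpace E] {U G : E → ℝ} {q : E}
    (hU : DifferentiableAt ℝ U q) (hG : DifferentiableAt ℝ G q) (hq : q ≠ 0) (ε s : ℝ) (p v : E) :
    fderiv ℝ (fun q' => (ε * U q' + ε * G q' + s) ^ 2 + ε * ⟪q', p⟫ - ⟪q', p⟫ / ‖q'‖) q v
      = 2 * (ε * U q + ε * G q + s) * ε * (⟪gradient U q, v⟫ + ⟪gradient G q, v⟫)
        + ε * ⟪p, v⟫ - (⟪p, v⟫ / ‖q‖ - ⟪q, p⟫ * ⟪q, v⟫ / ‖q‖ ^ 3) := by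
  have h1 := hasFDerivAt_inner_left p q
  have h := (((((hU.hasFDerivAt.const_mul ε).add (hG.hasFDerivAt.const_mul ε)).add_const s).pow
    2).add (h1.const_mul ε)).sub (hasFDerivAt_inner_div_norm hq p)
  have h' := h.fderiv
  simp only [gradient, InnerProductSpace.toDual_symm_apply]
  erw [h']
  simp
  ring

theorem hasFDerivAt_lyapunov_momentum {ε : ℝ} (hε : 0 < ε) (K : ℝ) (q p : E) :
    HasFDerivAt (fun p' : E => (K + √(1 + ε * ‖p'‖ ^ 2)) ^ 2 + ε * ⟪q, p'⟫ - ⟪q, p'⟫ / ‖q‖)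
      ((2 * ε * (K / √(1 + ε * ‖p‖ ^ 2) + 1)) • innerSL ℝ p + (ε - ‖q‖⁻¹) • innerSL ℝ q) p := by
  have h1 : HasFDerivAt (fun p : E => ⟪q, p⟫) (innerSL ℝ q) p := (innerSL ℝ q).hasFDerivAt
  have hs : √(1 + ε * ‖p‖ ^ 2) ≠ 0 := (Real.sqrt_pos.2 (one_add_mul_norm_sq_pos hε p)).ne'
  have h := (((((hasFDerivAt_sqrt_one_add_mul_norm_sq hε p).const_add K).pow 2).add
    (h1.const_mul ε)).sub (h1.mul_const ‖q‖⁻¹))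
  refine h.congr_fderiv ?_
  ext w
  simp
  field_simp
  ring

theorem fderiv_fderiv_lyapunov_momentum {ε : ℝ} (hε : 0 < ε) (K : ℝ) (q p w : E) :
    fderiv ℝ (fun p' => fderiv ℝ (fun p'' : E =>
        (K + √(1 + ε * ‖p''‖ ^ 2)) ^ 2 + ε * ⟪q, p''⟫ - ⟪q, p''⟫ / ‖q‖) p' w) p w
      = 2 * ε * (K / √(1 + ε * ‖p‖ ^ 2) + 1) * ‖w‖ ^ 2
        - 2 * ε ^ 2 * K / √(1 + ε * ‖p‖ ^ 2) ^ 3 * ⟪p, w⟫ ^ 2 := by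
  have hs : √(1 + ε * ‖p‖ ^ 2) ≠ 0 := (Real.sqrt_pos.2 (one_add_mul_norm_sq_pos hε p)).ne'
  have h0 : (fun p' => fderiv ℝ (fun p'' : E =>
        (K + √(1 + ε * ‖p''‖ ^ 2)) ^ 2 + ε * ⟪q, p''⟫ - ⟪q, p''⟫ / ‖q‖) p' w)
      = fun p' => (2 * ε * (K * (√(1 + ε * ‖p'‖ ^ 2))⁻¹ + 1)) * ⟪p', w⟫
        + (ε - ‖q‖⁻¹) * ⟪q, w⟫ := by
    funext p'
    rw [(hasFDerivAt_lyapunov_momentum hε K q p').fderiv]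
    simp [div_eq_mul_inv]
  have h1 := hasFDerivAt_inner_left w p
  have h := ((((((hasDerivAt_inv hs).comp_hasFDerivAt p
    (hasFDerivAt_sqrt_one_add_mul_norm_sq hε p)).const_mul K).add_const 1).const_mul (2 * ε)).mul
    h1).add_const ((ε - ‖q‖⁻¹) * ⟪q, w⟫)
  rw [h0]
  erw [h.fderiv]
  simp
  field_simp
  ring

end Derivatives

theorem L1_lyapunov_eq {d : ℕ} {ε : ℝ} (hε : 0 < ε) {U G : EuclideanSpace ℝ (Fin d) → ℝ}
    {q : EuclideanSpace ℝ (Fin d)} (hq : q ≠ 0) (hU : DifferentiableAt ℝ U q)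
    (hG : DifferentiableAt ℝ G q) (p : EuclideanSpace ℝ (Fin d)) {K s : ℝ}
    (hK : K = ε * U q + ε * G q) (hs : s = √(1 + ε * ‖p‖ ^ 2)) :
    L1 ε U G (fun q' p' => (H1 ε U G q' p') ^ 2 + ε * ⟪q', p'⟫ - ⟪q', p'⟫ / ‖q'‖) q p
      = -(2 * ε * (K + s) * ‖p‖ ^ 2 / s ^ 2)
        + (ε * ‖p‖ ^ 2 / s - (‖p‖ ^ 2 / ‖q‖ - ⟪q, p⟫ ^ 2 / ‖q‖ ^ 3) / s)
        - (ε - 1 / ‖q‖) * (⟪q, p⟫ / s + ⟪gradient U q, q⟫ + ⟪gradient G q, q⟫)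
        + 2 * ε * d * (K / s + 1) - 2 * ε ^ 2 * K * ‖p‖ ^ 2 / s ^ 3 := by
  have hn : ‖q‖ ≠ 0 := norm_ne_zero_iff.2 hq
  have hs0 : s ≠ 0 := hs ▸ (Real.sqrt_pos.2 (one_add_mul_norm_sq_pos hε p)).ne'
  have hsum : ∑ i : Fin d, ⟪p, EuclideanSpace.single i (1 : ℝ)⟫ ^ 2 = ‖p‖ ^ 2 := by
    simp [EuclideanSpace.real_norm_sq_eq, EuclideanSpace.inner_single_right]
  have hmom (a : EuclideanSpace ℝ (Fin d)) : ⟪a, gradient (fun p' =>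
      (K + √(1 + ε * ‖p'‖ ^ 2)) ^ 2 + ε * ⟪q, p'⟫ - ⟪q, p'⟫ / ‖q‖) p⟫
      = 2 * ε * (K / s + 1) * ⟪a, p⟫ + (ε - ‖q‖⁻¹) * ⟪a, q⟫ := by
    rw [real_inner_comm, inner_gradient_left, (hasFDerivAt_lyapunov_momentum hε K q p).fderiv, hs]
    simp [real_inner_comm a]
  have hlap : ∑ i : Fin d, (2 * ε * (K / s + 1) * ‖EuclideanSpace.single i (1 : ℝ)‖ ^ 2
      - 2 * ε ^ 2 * K / s ^ 3 * ⟪p, EuclideanSpace.single i (1 : ℝ)⟫ ^ 2)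
      = 2 * ε * (K / s + 1) * d - 2 * ε ^ 2 * K / s ^ 3 * ‖p‖ ^ 2 := by
    rw [Finset.sum_sub_distrib, ← Finset.mul_sum, ← Finset.mul_sum, hsum]
    simp
  unfold L1
  simp only [H1, ← hK]
  rw [real_inner_comm, inner_gradient_left, fderiv_lyapunov_position hU hG hq, ← hK, hmom]
  simp_rw [fderiv_fderiv_lyapunov_momentum hε K q p, ← hs]
  rw [hlap]
  simp only [inner_sub_left, inner_neg_left, real_inner_smul_left, real_inner_smul_right,
    real_inner_self_eq_norm_sq, real_inner_comm q p]
  field_simp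
  ring

/-- Scalar form of the dissipation estimate: here `n = ‖p‖`, `r = ‖q‖`, `w = ⟪q, p⟫`,
`u = ⟪∇U(q) + ∇G(q), q⟫` and `K = ε(U(q) + G(q))`. -/
theorem lyapunov_drift_le {ε d K s n r w u M T R : ℝ} (hε : 0 < ε) (hε1 : ε ≤ 1) (hd : 0 ≤ d)
    (hK : 0 ≤ K) (hs1 : 1 ≤ s) (hs : s ^ 2 = 1 + ε * n ^ 2) (hr : 0 < r)
    (hw : |w| ≤ r * n) (hnM : n ≤ M * s) (hM : 0 ≤ M) (hT : u ≤ r * T) (hR : -u ≤ R) :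
    -(2 * ε * (K + s) * n ^ 2 / s ^ 2) + (ε * n ^ 2 / s - (n ^ 2 / r - w ^ 2 / r ^ 3) / s)
        - (ε - 1 / r) * (w / s + u) + 2 * ε * d * (K / s + 1) - 2 * ε ^ 2 * K * n ^ 2 / s ^ 3
      ≤ -s + 2 + M * (r + 1) + T + ε * R + 2 * ε * d * (K + 1) := by
  have hs0 : 0 < s := by linarith
  have hdiss : -(2 * ε * (K + s) * n ^ 2 / s ^ 2) + ε * n ^ 2 / s ≤ -s + 2 := by
    have e : -(2 * ε * (K + s) * n ^ 2 / s ^ 2) + ε * n ^ 2 / s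
        = -(2 * ε * K * n ^ 2 / s ^ 2) - ε * n ^ 2 / s := by
      field_simp
      ring
    have hn : ε * n ^ 2 = s ^ 2 - 1 := by linarith
    have e2 : (s ^ 2 - 1) / s = s - 1 / s := by field_simp
    have : 0 ≤ 2 * ε * K * n ^ 2 / s ^ 2 := by positivity
    have : 1 / s ≤ 1 := by rw [div_le_one hs0]; exact hs1
    rw [e, hn, e2]
    linarith
  have hcs : 0 ≤ (n ^ 2 / r - w ^ 2 / r ^ 3) / s := by
    have : w ^ 2 ≤ r ^ 2 * n ^ 2 := by
      have := pow_le_pow_left₀ (abs_nonneg w) hw 2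
      rwa [sq_abs, mul_pow] at this
    have e : n ^ 2 / r - w ^ 2 / r ^ 3 = (r ^ 2 * n ^ 2 - w ^ 2) / r ^ 3 := by field_simp
    rw [e]
    exact div_nonneg (div_nonneg (by linarith) (by positivity)) hs0.le
  have hws : |w / s| ≤ M * r := by
    rw [abs_div, abs_of_pos hs0, div_le_iff₀ hs0]
    nlinarith
  have hwl := (abs_le.1 hws).1
  have hcross : -(ε - 1 / r) * (w / s) ≤ M * (r + 1) := by
    have h1 : 1 / r * (w / s) ≤ M := by
      rw [one_div_mul_eq_div, div_le_iff₀ hr]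
      exact (abs_le.1 hws).2
    have h2 : 0 ≤ M * r := by positivity
    nlinarith
  have hforce : -(ε - 1 / r) * u ≤ T + ε * R := by
    have h1 : 1 / r * u ≤ T := by
      rw [one_div_mul_eq_div, div_le_iff₀ hr]
      linarith
    nlinarith
  have hlap : 2 * ε * d * (K / s + 1) ≤ 2 * ε * d * (K + 1) := by
    have := div_le_self hK hs1
    gcongr
  have : 0 ≤ 2 * ε ^ 2 * K * n ^ 2 / s ^ 3 := by positivity
  linarith

/-- The radial derivative of a potential with the prescribed singular structure at the origin. -/
theorem abs_inner_add_singular_le {E : Type*} [NormedAddCommGroup E] [InnerProductSpace ℝ E]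
    {g q : E} {a₄ a₅ a₆ β₁ β₂ : ℝ} (hq : q ≠ 0)
    (h : ‖g + (a₄ / ‖q‖ ^ (β₁ + 1)) • q + (a₅ / ‖q‖ ^ (β₂ + 1)) • q‖ ≤ a₆) :
    |⟪g, q⟫ + ‖q‖ * (a₄ * ‖q‖ ^ (-β₁) + a₅ * ‖q‖ ^ (-β₂))| ≤ a₆ * ‖q‖ := by
  have hr : 0 < ‖q‖ := norm_pos_iff.2 hq
  have h1 := (abs_real_inner_le_norm _ q).trans (mul_le_mul_of_nonneg_right h hr.le)
  have e : ⟪g, q⟫ + ‖q‖ * (a₄ * ‖q‖ ^ (-β₁) + a₅ * ‖q‖ ^ (-β₂))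
      = ⟪g + (a₄ / ‖q‖ ^ (β₁ + 1)) • q + (a₅ / ‖q‖ ^ (β₂ + 1)) • q, q⟫ := by
    simp only [inner_add_left, real_inner_smul_left, real_inner_self_eq_norm_sq,
      Real.rpow_add hr, Real.rpow_neg hr.le, Real.rpow_one]
    field_simp
    ring
  rwa [e]

/-- The lower-order terms in the drift are absorbed by the confining powers. -/
theorem exists_lower_order_bound {A B lam β₁ β₂ : ℝ} (hA : 0 < A) (hB : 0 < B) (hlam : 1 ≤ lam)
    (hβ₁ : 1 ≤ β₁) (hβ₂0 : 0 ≤ β₂) (hβ₂1 : β₂ < β₁) {K₁ K₂ K₃ K₄ K₅ : ℝ}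
    (hK₁ : 0 ≤ K₁) (hK₂ : 0 ≤ K₂) (hK₃ : 0 ≤ K₃) (hK₄ : 0 ≤ K₄) (hK₅ : 0 ≤ K₅) :
    ∃ C : ℝ, 0 ≤ C ∧ ∀ r : ℝ, 0 < r →
      K₁ * r + K₂ * r ^ lam + K₃ * r ^ (-β₂) + K₄ * (r * r ^ (-β₁)) + K₅ * (r * r ^ (-β₂))
        ≤ A * r ^ (lam + 1) + B * r ^ (-β₁) + C := by
  have key {K e : ℝ} (hK : 0 ≤ K) (h1 : -β₁ < e) (h2 : e < lam + 1) :=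
    exists_mul_rpow_le_add_rpow (A := A / 5) (B := B / 5) (by positivity) (by positivity) hK h1 h2
  obtain ⟨C₁, hC₁, h₁⟩ := key (e := 1) hK₁ (by linarith) (by linarith)
  obtain ⟨C₂, hC₂, h₂⟩ := key (e := lam) hK₂ (by linarith) (by linarith)
  obtain ⟨C₃, hC₃, h₃⟩ := key (e := -β₂) hK₃ (by linarith) (by linarith)
  obtain ⟨C₄, hC₄, h₄⟩ := key (e := 1 + -β₁) hK₄ (by linarith) (by linarith)
  obtain ⟨C₅, hC₅, h₅⟩ := key (e := 1 + -β₂) hK₅ (by linarith) (by linarith)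
  refine ⟨C₁ + C₂ + C₃ + C₄ + C₅, by positivity, fun r hr => ?_⟩
  have h₁ := h₁ r hr
  have h₄ := h₄ r hr
  have h₅ := h₅ r hr
  rw [Real.rpow_one] at h₁
  rw [Real.rpow_add hr 1, Real.rpow_one] at h₄ h₅
  linarith [h₂ r hr, h₃ r hr]

/-- Inequality (3.14) in the proof of Lemma 3.1: under Assumptions (U) and (G1) and the
normalization `U + G ≥ 1`, there exist `ε₀ ∈ (0,1)` and `c > 0` (independent of `ε`)
such that for every `ε ∈ (0,ε₀)` there is `C > 0` with
`L₁(H² + ε⟨q,p⟩ − ⟨q,p⟩/|q|) ≤ −cH + C` on `(ℝ^d ∖ {0}) × ℝ^d`. -/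
theorem stmt_11 (d : ℕ) (hd : 1 ≤ d)
    (U G : EuclideanSpace ℝ (Fin d) → ℝ)
    (a₁ lam a₂ a₃ β₁ β₂ a₄ a₅ a₆ : ℝ)
    (ha₁ : 0 < a₁) (hlam : 1 ≤ lam) (ha₂ : 0 < a₂) (ha₃ : 0 < a₃)
    (hβ₁ : 1 ≤ β₁) (hβ₂0 : 0 ≤ β₂) (hβ₂1 : β₂ < β₁) (ha₄ : 0 < a₄) (ha₆ : 0 < a₆)
    (hUsmooth : ContDiff ℝ (⊤ : ℕ∞) U)
    (hUone : ∀ q, 1 ≤ U q)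
    (hUlow : ∀ q : EuclideanSpace ℝ (Fin d), (1 / a₁) * ‖q‖ ^ (lam + 1) - a₁ ≤ U q)
    (hUup : ∀ q : EuclideanSpace ℝ (Fin d), U q ≤ a₁ * (1 + ‖q‖ ^ (lam + 1)))
    (hUgrad : ∀ q : EuclideanSpace ℝ (Fin d), ‖gradient U q‖ ≤ a₁ * (1 + ‖q‖ ^ lam))
    (hUcoer : ∀ q : EuclideanSpace ℝ (Fin d), a₂ * ‖q‖ ^ (lam + 1) - a₃ ≤ ⟪gradient U q, q⟫)
    (hGsmooth : ContDiffOn ℝ (⊤ : ℕ∞) G {(0 : EuclideanSpace ℝ (Fin d))}ᶜ)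
    (hGblow : Filter.Tendsto G (nhdsWithin 0 {(0 : EuclideanSpace ℝ (Fin d))}ᶜ) Filter.atTop)
    (hGeven : ∀ q, G (-q) = G q)
    (hGodd : ∀ q : EuclideanSpace ℝ (Fin d), q ≠ 0 → gradient G (-q) = -gradient G q)
    (hGbd : ∀ q : EuclideanSpace ℝ (Fin d), q ≠ 0 →
      |G q| ≤ a₁ * (1 + ‖q‖ + ‖q‖ ^ (-β₁)))
    (hGgradbd : ∀ q : EuclideanSpace ℝ (Fin d), q ≠ 0 →
      ‖gradient G q‖ ≤ a₁ * (1 + ‖q‖ ^ (-β₁)))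
    (hGstruct : ∀ q : EuclideanSpace ℝ (Fin d), q ≠ 0 →
      ‖gradient G q + (a₄ / ‖q‖ ^ (β₁ + 1)) • q + (a₅ / ‖q‖ ^ (β₂ + 1)) • q‖ ≤ a₆)
    (hUG : ∀ q : EuclideanSpace ℝ (Fin d), q ≠ 0 → 1 ≤ U q + G q) :
    ∃ ε₀ c : ℝ, ε₀ ∈ Set.Ioo (0 : ℝ) 1 ∧ 0 < c ∧
      ∀ ε : ℝ, ε ∈ Set.Ioo (0 : ℝ) ε₀ →
        ∃ C : ℝ, 0 < C ∧
          ∀ q : EuclideanSpace ℝ (Fin d), q ≠ 0 → ∀ p : EuclideanSpace ℝ (Fin d),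
            L1 ε U G
                (fun q' p' => (H1 ε U G q' p') ^ 2 + ε * ⟪q', p'⟫ - ⟪q', p'⟫ / ‖q'‖)
                q p
              ≤ -c * H1 ε U G q p + C := by
  have hd0 : (0 : ℝ) < d := by exact_mod_cast hd
  obtain ⟨c, hc, hc1, hc2, hc3⟩ : ∃ c : ℝ, 0 < c ∧ c ≤ 1 ∧ 4 * a₁ * c ≤ a₂ ∧ 4 * a₁ * c ≤ a₄ := by
    refine ⟨min 1 (min (a₂ / (4 * a₁)) (a₄ / (4 * a₁))), by positivity, min_le_left _ _, ?_, ?_⟩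
    · rw [mul_comm, ← le_div_iff₀ (by positivity)]
      exact (min_le_right _ _).trans (min_le_left _ _)
    · rw [mul_comm, ← le_div_iff₀ (by positivity)]
      exact (min_le_right _ _).trans (min_le_right _ _)
  refine ⟨min (1 / 2) (c / (2 * d)), c, ⟨by positivity, (min_le_left _ _).trans_lt (by norm_num)⟩,
    hc, fun ε ⟨hε, hε0⟩ => ?_⟩
  have hε1 : ε ≤ 1 := hε0.le.trans ((min_le_left _ _).trans (by norm_num))
  have hεd : 2 * ε * d ≤ c := by
    have := hε0.le.trans (min_le_right _ _)
    rw [le_div_iff₀ (by positivity)] at this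
    linarith
  set M := 1 / √ε
  have hM : 0 ≤ M := by positivity
  obtain ⟨C, hC, hlow⟩ := exists_lower_order_bound (A := ε * a₂ / 2) (B := a₄ / 2)
    (lam := lam) (β₁ := β₁) (β₂ := β₂) (K₁ := M + ε * a₆ + a₂ * ε) (K₂ := a₁) (K₃ := |a₅|)
    (K₄ := ε * a₄) (K₅ := ε * |a₅|) (by positivity) (by positivity) hlam hβ₁ hβ₂0 hβ₂1
    (by positivity) ha₁.le (abs_nonneg _) (by positivity) (by positivity)
  refine ⟨C + 2 + M + a₁ + a₆ + ε * a₃ + c + a₂ * ε, by positivity, fun q hq p => ?_⟩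
  have hr : 0 < ‖q‖ := norm_pos_iff.2 hq
  have hUd : DifferentiableAt ℝ U q := hUsmooth.differentiable (by simp) q
  have hGd : DifferentiableAt ℝ G q :=
    (hGsmooth.contDiffAt (isOpen_compl_singleton.mem_nhds hq)).differentiableAt (by simp)
  rw [L1_lyapunov_eq hε hq hUd hGd p rfl rfl]
  unfold H1
  have hKdef : ε * U q + ε * G q = ε * (U q + G q) := by ring
  set s := √(1 + ε * ‖p‖ ^ 2)
  set K := ε * U q + ε * G q
  have hs : s ^ 2 = 1 + ε * ‖p‖ ^ 2 := Real.sq_sqrt (by positivity)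
  have hs1 : 1 ≤ s := Real.one_le_sqrt.2 (by nlinarith [sq_nonneg ‖p‖])
  have hK : 0 ≤ K := by
    rw [hKdef]
    exact mul_nonneg hε.le (zero_le_one.trans (hUG q hq))
  have hnM : ‖p‖ ≤ M * s := by
    rw [one_div_mul_eq_div, le_div_iff₀ (by positivity)]
    refine Real.le_sqrt_of_sq_le ?_
    rw [mul_pow, Real.sq_sqrt hε.le]
    linarith
  obtain ⟨hGl, hGu⟩ := abs_le.1 (abs_inner_add_singular_le hq (hGstruct q hq))
  have hUu : ⟪gradient U q, q⟫ ≤ a₁ * (1 + ‖q‖ ^ lam) * ‖q‖ :=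
    (real_inner_le_norm _ _).trans (mul_le_mul_of_nonneg_right (hUgrad q) hr.le)
  have hdrift := lyapunov_drift_le (u := ⟪gradient U q, q⟫ + ⟪gradient G q, q⟫)
    (T := a₁ * (1 + ‖q‖ ^ lam) + a₆ - (a₄ * ‖q‖ ^ (-β₁) + a₅ * ‖q‖ ^ (-β₂)))
    (R := a₃ - a₂ * ‖q‖ ^ (lam + 1) + a₆ * ‖q‖
      + ‖q‖ * (a₄ * ‖q‖ ^ (-β₁) + a₅ * ‖q‖ ^ (-β₂)))
    hε hε1 hd0.le hK hs1 hs hr (abs_real_inner_le_norm q p) hnM hM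
    (by linarith) (by linarith [hUcoer q])
  rw [← add_assoc] at hdrift
  refine hdrift.trans ?_
  have hx : 0 ≤ ‖q‖ ^ (-β₁) := by positivity
  have hy : 0 ≤ ‖q‖ ^ (-β₂) := by positivity
  have hz : 0 ≤ ‖q‖ ^ (lam + 1) := by positivity
  have hlow := hlow ‖q‖ hr
  set x := ‖q‖ ^ (-β₁)
  set y := ‖q‖ ^ (-β₂)
  set z := ‖q‖ ^ (lam + 1)
  have hUGb : U q + G q ≤ a₁ * (2 + z + ‖q‖ + x) := by
    linarith [(le_abs_self _).trans (hGbd q hq), hUup q]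
  clear_value K s M x y z
  have ha₅y : -(a₅ * y) ≤ |a₅| * y := by nlinarith [neg_abs_le a₅]
  have ha₅ry : ε * (‖q‖ * (a₅ * y)) ≤ ε * |a₅| * (‖q‖ * y) := by
    have := mul_le_mul_of_nonneg_right (le_abs_self a₅) (by positivity : 0 ≤ ε * (‖q‖ * y))
    linarith
  have hKup : (2 * ε * d + c) * K ≤ ε * a₂ / 2 * z + a₂ * ε + a₂ * ε * ‖q‖ + a₄ / 2 * x := by
    have hF : K ≤ ε * (a₁ * (2 + z + ‖q‖ + x)) := by
      rw [hKdef]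
      exact mul_le_mul_of_nonneg_left hUGb hε.le
    have h1 : (2 * ε * d + c) * K ≤ 2 * c * (ε * (a₁ * (2 + z + ‖q‖ + x))) :=
      mul_le_mul (by linarith) hF hK (by positivity)
    have h2 := mul_le_mul_of_nonneg_right hc2 (by positivity : 0 ≤ ε * (2 + z + ‖q‖))
    have h3 := mul_le_mul_of_nonneg_right hc3 (by positivity : 0 ≤ ε * x)
    have h4 : a₄ * (ε * x) ≤ a₄ * x := by
      exact mul_le_mul_of_nonneg_left (mul_le_of_le_one_left hx hε1) ha₄.le
    have h5 : 0 ≤ a₂ * ε * ‖q‖ := by positivity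
    linarith
  have hcs : c * s ≤ s := mul_le_of_le_one_left (by linarith) hc1
  linarith
end
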